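/- arXiv:2605.20396 — 4 statements merged into one kernel-verified Lean document; each statement's English description precedes it below -/
import Mathlib

section
/- Orthogonal transformation lemma: Let B be an m×n real matrix, C an n×n real matrix with I − C invertible, Ω_X an m×m matrix, and Σ_X an m×m matrix satisfying Σ_X = B(I−C)⁻¹(I−C)⁻ᵀ Bᵀ + Ω_X. For any n×n orthogonal matrix Q (i.e., Q Qᵀ = I), setting B̃ = B Q and C̃ = Qᵀ C Q, the matrix I − C̃ is invertible and Σ_X = B̃(I−C̃)⁻¹(I−C̃)⁻ᵀ B̃ᵀ + Ω_X. -/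
open Matrix

/-- **Orthogonal transformation lemma.** If `Σ_X = B (I−C)⁻¹ (I−C)⁻ᵀ Bᵀ + Ω_X` with `I − C`
invertible, then for any orthogonal `Q` (`Q Qᵀ = I`), setting `B̃ = B Q` and `C̃ = Qᵀ C Q`,
the matrix `I − C̃` is invertible and `Σ_X = B̃ (I−C̃)⁻¹ (I−C̃)⁻ᵀ B̃ᵀ + Ω_X`. -/
theorem orthogonal_transformation {m n : ℕ}
    (B : Matrix (Fin m) (Fin n) ℝ) (C Q : Matrix (Fin n) (Fin n) ℝ)
    (hInv : IsUnit (1 - C))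
    (OmegaX Sx : Matrix (Fin m) (Fin m) ℝ)
    (hSx : Sx = B * (1 - C)⁻¹ * ((1 - C)⁻¹)ᵀ * Bᵀ + OmegaX)
    (hQ : Q * Qᵀ = 1) :
    IsUnit (1 - Qᵀ * C * Q) ∧
    Sx = (B * Q) * (1 - Qᵀ * C * Q)⁻¹ * ((1 - Qᵀ * C * Q)⁻¹)ᵀ * (B * Q)ᵀ + OmegaX := by
  have hQ' : Qᵀ * Q = 1 := mul_eq_one_comm.mp hQ
  have hconj : 1 - Qᵀ * C * Q = Qᵀ * (1 - C) * Q := by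
    rw [Matrix.mul_sub, Matrix.sub_mul, Matrix.mul_one, hQ']
  have hinv : (1 - Qᵀ * C * Q)⁻¹ = Qᵀ * (1 - C)⁻¹ * Q := by
    rw [hconj, Matrix.mul_inv_rev, Matrix.mul_inv_rev, Matrix.inv_eq_right_inv hQ,
      Matrix.inv_eq_right_inv hQ', Matrix.mul_assoc]
  have hcancel {k : ℕ} (M : Matrix (Fin n) (Fin k) ℝ) : Q * (Qᵀ * M) = M := by
    rw [← Matrix.mul_assoc, hQ, Matrix.one_mul]
  refine ⟨?_, ?_⟩
  · rw [hconj]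
    exact ((IsUnit.of_mul_eq_one Q hQ').mul hInv).mul (IsUnit.of_mul_eq_one Qᵀ hQ)
  · rw [hinv, hSx]
    simp only [Matrix.transpose_mul, Matrix.transpose_transpose, Matrix.mul_assoc, hcancel]
end

section
/- Proposition (degrees of freedom of 1-factor models): Let G be a pattern with m measured and n latent variables such that every row of B_G has exactly one nonzero entry (each measured variable has a single latent parent) and every column of B_G has at least three nonzero entries (each latent variable has at least three measured children). Then dim(G) = |G| + m, where |G| = |supp(B_G)| + |supp(C_G)|. -/
open Matrix

noncomputable section

/-- A pattern (graph) `G` with `m` measured and `n` latent variables, given by a binary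
matrix `B ∈ {0,1}^{m×n}` (edges from latents to measured variables) and a strictly upper
triangular binary matrix `C ∈ {0,1}^{n×n}` (edges among latents). -/
structure Pattern (m n : ℕ) where
  B : Matrix (Fin m) (Fin n) ℕ
  C : Matrix (Fin n) (Fin n) ℕ
  hB : ∀ i j, B i j ≤ 1
  hC : ∀ i j, C i j ≤ 1
  hCstrict : ∀ i j : Fin n, j ≤ i → C i j = 0

/-- The number of edges `|G|` of a pattern. -/
def Pattern.edges {m n : ℕ} (G : Pattern m n) : ℕ :=
  (Finset.univ.filter fun p : Fin m × Fin n => G.B p.1 p.2 ≠ 0).card +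
  (Finset.univ.filter fun p : Fin n × Fin n => G.C p.1 p.2 ≠ 0).card

/-- The distribution set `M(G)`: all covariance matrices
`Σ_X = B (I−C)⁻¹ Ω_L (I−C)⁻ᵀ Bᵀ + Ω_X` where `supp B ⊆ supp B_G`, `C` is strictly upper
triangular with `supp C ⊆ supp C_G`, and `Ω_X, Ω_L` are diagonal with positive entries. -/
def Pattern.distSet {m n : ℕ} (G : Pattern m n) : Set (Matrix (Fin m) (Fin m) ℝ) :=
  { Sx | ∃ (B : Matrix (Fin m) (Fin n) ℝ) (C : Matrix (Fin n) (Fin n) ℝ)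
        (dX : Fin m → ℝ) (dL : Fin n → ℝ),
      (∀ i j, G.B i j = 0 → B i j = 0) ∧
      (∀ i j : Fin n, j ≤ i → C i j = 0) ∧
      (∀ i j, G.C i j = 0 → C i j = 0) ∧
      (∀ i, 0 < dX i) ∧ (∀ i, 0 < dL i) ∧
      Sx = B * (1 - C)⁻¹ * Matrix.diagonal dL * ((1 - C)⁻¹)ᵀ * Bᵀ + Matrix.diagonal dX }

/-- The vanishing ideal `H(G)` of the distribution set `M(G)`: all real polynomials in the
`m²` matrix-entry variables vanishing at every element of `M(G)`. -/
def Pattern.vanishingIdeal {m n : ℕ} (G : Pattern m n) :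
    Ideal (MvPolynomial (Fin m × Fin m) ℝ) where
  carrier := { p | ∀ Sx ∈ G.distSet, MvPolynomial.eval (fun q => Sx q.1 q.2) p = 0 }
  add_mem' := by
    intro a b ha hb Sx hSx
    simp [ha Sx hSx, hb Sx hSx]
  zero_mem' := by
    intro Sx hSx
    simp
  smul_mem' := by
    intro c x hx Sx hSx
    simp [smul_eq_mul, hx Sx hSx]

/-- The model dimension `dim(G)`: the Krull dimension of the quotient of the real polynomial
ring in the `m²` matrix-entry variables by the vanishing ideal `H(G)`. -/
def Pattern.dim {m n : ℕ} (G : Pattern m n) : WithBot ℕ∞ :=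
  ringKrullDim (MvPolynomial (Fin m × Fin m) ℝ ⧸ G.vanishingIdeal)

theorem ringKrullDim_eq_of_isIntegral {R S : Type*} [CommRing R] [CommRing S] [Algebra R S]
    [Algebra.IsIntegral R S] (h : Function.Injective (algebraMap R S)) :
    ringKrullDim S = ringKrullDim R := by
  have : FaithfulSMul R S := (faithfulSMul_iff_algebraMap_injective R S).mpr h
  refine le_antisymm ?_ ?_
  · exact Order.krullDim_le_of_strictMono (PrimeSpectrum.comap (algebraMap R S))
      fun I J hIJ => Ideal.IsIntegral.comap_lt_comap hIJ
  · refine iSup_le fun l => ?_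
    obtain ⟨Q, hQ, hlo⟩ : ∃ Q : Ideal S, Q.IsPrime ∧ Q.LiesOver l.head.asIdeal := by
      obtain ⟨Q, -, hQ, hc⟩ := Ideal.exists_ideal_over_prime_of_isIntegral
        l.head.asIdeal (⊥ : Ideal S) (by simp [← RingHom.ker_eq_comap_bot])
      exact ⟨Q, hQ, ⟨hc.symm⟩⟩
    obtain ⟨L, hL, -⟩ := Ideal.exists_ltSeries_of_hasGoingUp l Q
    rw [← hL]
    exact Order.LTSeries.length_le_krullDim L

/-- A finitely generated algebra over which a polynomial ring is algebraic has the dimension of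
that polynomial ring. -/
theorem ringKrullDim_eq_of_mvPolynomial_isAlgebraic {k A ι : Type} [Field k] [CommRing A]
    [Algebra k A] [Algebra.FiniteType k A] [Fintype ι] [Algebra A (MvPolynomial ι k)]
    [IsScalarTower k A (MvPolynomial ι k)] [FaithfulSMul A (MvPolynomial ι k)]
    [Algebra.IsAlgebraic A (MvPolynomial ι k)] :
    ringKrullDim A = (Fintype.card ι : WithBot ℕ∞) := by
  have hinj := FaithfulSMul.algebraMap_injective A (MvPolynomial ι k)
  have : IsDomain A := hinj.isDomain
  obtain ⟨s, g, hg, hint⟩ := exists_integral_inj_algHom_of_fg k A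
  let _ := g.toRingHom.toAlgebra
  have : IsScalarTower k (MvPolynomial (Fin s) k) A := .of_algebraMap_eq' g.comp_algebraMap.symm
  have : Algebra.IsIntegral (MvPolynomial (Fin s) k) A := ⟨hint⟩
  have : FaithfulSMul (MvPolynomial (Fin s) k) A :=
    (faithfulSMul_iff_algebraMap_injective _ _).mpr hg
  rw [ringKrullDim_eq_of_isIntegral (R := MvPolynomial (Fin s) k) hg,
    MvPolynomial.ringKrullDim_of_isNoetherianRing, ringKrullDim_eq_zero_of_field]
  have h1 := trdeg_add_eq k (MvPolynomial (Fin s) k) (A := A)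
  have h2 := trdeg_add_eq k A (A := MvPolynomial ι k)
  have h3 : Algebra.trdeg (MvPolynomial (Fin s) k) A = 0 := trdeg_eq_zero
  have h4 : Algebra.trdeg A (MvPolynomial ι k) = 0 := trdeg_eq_zero
  rw [← h1, h3, h4] at h2
  simp at h2
  simp [h2]

/-- The entries of an upper triangular matrix `V` are determined by `V * Vᵀ` using only
subtraction, division and square roots. -/
theorem Matrix.upperTriangular_mem_of_mul_transpose_mem {P : Type*} [CommRing P] [IsDomain P]
    (F : Subring P)
    (hdiv : ∀ x y, x ∈ F → x ≠ 0 → x * y ∈ F → y ∈ F) (hsq : ∀ x, x * x ∈ F → x ∈ F)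
    {n : ℕ} (V : Matrix (Fin n) (Fin n) P) (hV : ∀ i j, j < i → V i j = 0)
    (hdiag : ∀ i, V i i ≠ 0) (hN : ∀ i j, (V * Vᵀ) i j ∈ F) (i j : Fin n) : V i j ∈ F := by
  induction j using WellFoundedGT.induction generalizing i with
  | ind q ih =>
    have key : ∀ i, V i q * V q q ∈ F := fun i => by
      have h : (V * Vᵀ) i q - ∑ r ∈ Finset.univ.erase q, V i r * V q r = V i q * V q q := by
        rw [Matrix.mul_apply, ← Finset.add_sum_erase _ _ (Finset.mem_univ q)]
        simp
      rw [← h]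
      refine F.sub_mem (hN i q) (F.sum_mem fun r hr => ?_)
      rcases lt_or_gt_of_ne (Finset.ne_of_mem_erase hr) with h | h
      · simp [hV q r h]
      · exact F.mul_mem (ih r h i) (ih r h q)
    exact hdiv _ _ (hsq _ (key q)) (hdiag q) (mul_comm (V i q) _ ▸ key i)

theorem Matrix.det_one_sub_of_strictUpper {R : Type*} [CommRing R] {n : ℕ}
    (C : Matrix (Fin n) (Fin n) R) (hC : ∀ i j, j ≤ i → C i j = 0) : (1 - C).det = 1 := by
  rw [Matrix.det_of_isUpperTriangular]
  · simp [hC]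
  · intro i j hij
    have hij : j < i := hij
    simp [hC i j hij.le, Matrix.one_apply_ne hij.ne']

theorem Matrix.inv_mem_of_mem {P : Type*} [CommRing P] (F : Subring P) {n : ℕ}
    (U : Matrix (Fin n) (Fin n) P) (hdet : U.det = 1) (hU : ∀ i j, U i j ∈ F) (i j : Fin n) :
    U⁻¹ i j ∈ F := by
  rw [Matrix.inv_def, hdet, Ring.inverse_one, one_smul, Matrix.adjugate_apply, Matrix.det_apply]
  refine F.sum_mem fun σ _ => ?_
  rw [Units.smul_def]
  refine F.zsmul_mem (F.prod_mem fun k _ => ?_) _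
  rw [Matrix.updateRow_apply, Pi.single_apply]
  split_ifs
  exacts [F.one_mem, F.zero_mem, hU _ _]

theorem Matrix.inv_one_sub_strictUpper {R : Type*} [CommRing R] {n : ℕ}
    (C : Matrix (Fin n) (Fin n) R) (hC : ∀ i j, j ≤ i → C i j = 0) :
    (∀ i j, j < i → (1 - C)⁻¹ i j = 0) ∧ ∀ i, (1 - C)⁻¹ i i = 1 := by
  have hdet := Matrix.det_one_sub_of_strictUpper C hC
  have hT : (1 - C).BlockTriangular id := fun i j hij => by
    have hij : j < i := hij
    simp [hC i j hij.le, Matrix.one_apply_ne hij.ne']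
  have : Invertible (1 - C) := Matrix.invertibleOfIsUnitDet _ (by simp [hdet])
  have hI : (1 - C)⁻¹.BlockTriangular id := Matrix.blockTriangular_inv_of_blockTriangular hT
  have h0 : ∀ i j, j < i → (1 - C)⁻¹ i j = 0 := fun i j h => hI h
  refine ⟨h0, fun i => ?_⟩
  have h1 : ((1 - C) * (1 - C)⁻¹) i i = 1 := by
    rw [Matrix.mul_nonsing_inv _ (by simp [hdet])]; simp
  rw [Matrix.mul_apply, Finset.sum_eq_single i] at h1
  · simpa [hC] using h1
  · intro j _ hj
    rcases lt_or_gt_of_ne hj with h | h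
    · simp [hC i j h.le, Matrix.one_apply_ne hj.symm]
    · simp [h0 j i h]
  · simp

/-- The covariance matrix of the latent variables with edge coefficients `C` and unit noise
variances. -/
def latentCov {R : Type*} [CommRing R] {n : ℕ} (C : Matrix (Fin n) (Fin n) R) :
    Matrix (Fin n) (Fin n) R :=
  (1 - C)⁻¹ * ((1 - C)⁻¹)ᵀ

/-- The covariance matrix of the measured variables in a 1-factor model: `par i` is the latent
parent of `i`, with coefficient `b i`, and all latent noise variances are one. -/
def oneFactorCov {R : Type*} [CommRing R] {m n : ℕ} (par : Fin m → Fin n) (b : Fin m → R)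
    (C : Matrix (Fin n) (Fin n) R) (d : Fin m → R) : Matrix (Fin m) (Fin m) R :=
  fun i j => b i * b j * latentCov C (par i) (par j) + if i = j then d i else 0

theorem oneFactorCov_map {R S : Type*} [CommRing R] [CommRing S] (f : R →+* S) {m n : ℕ}
    (par : Fin m → Fin n) (b : Fin m → R) (C : Matrix (Fin n) (Fin n) R)
    (hC : ∀ i j, j ≤ i → C i j = 0) (d : Fin m → R) (i j : Fin m) :
    f (oneFactorCov par b C d i j) =
      oneFactorCov par (fun i => f (b i)) (C.map f) (fun i => f (d i)) i j := by
  have hdet := Matrix.det_one_sub_of_strictUpper C hC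
  have hinv : (1 - C.map f)⁻¹ = (1 - C)⁻¹.map f := by
    refine Matrix.inv_eq_left_inv ?_
    have h1 : (1 - C.map f) = (1 - C).map f := by
      rw [Matrix.map_sub _ (map_sub f), Matrix.map_one _ (map_zero f) (map_one f)]
    rw [h1, ← Matrix.map_mul, Matrix.nonsing_inv_mul _ (by simp [hdet]),
      Matrix.map_one _ (map_zero f) (map_one f)]
  simp only [oneFactorCov, latentCov, hinv, ← Matrix.transpose_map, ← Matrix.map_mul, map_add, map_mul,
    Matrix.map_apply, apply_ite f, map_zero]

/-- Generic identifiability: the parameters of a 1-factor model in which every latent variable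
has at least three children are obtained from the covariance matrix by ring operations, division
and square roots. -/
theorem mem_of_oneFactorCov_mem {P : Type*} [CommRing P] [IsDomain P] (F : Subring P)
    (hdiv : ∀ x y, x ∈ F → x ≠ 0 → x * y ∈ F → y ∈ F) (hsq : ∀ x, x * x ∈ F → x ∈ F)
    {m n : ℕ} (par : Fin m → Fin n) (hpar : Function.Surjective par)
    (hsib : ∀ i, ∃ j k, j ≠ i ∧ k ≠ i ∧ j ≠ k ∧ par j = par i ∧ par k = par i)
    (b : Fin m → P) (C : Matrix (Fin n) (Fin n) P) (hC : ∀ i j, j ≤ i → C i j = 0)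
    (d : Fin m → P) (hb : ∀ i, b i ≠ 0)
    (hW : ∀ p, latentCov C p p ≠ 0)
    (hS : ∀ i j, oneFactorCov par b C d i j ∈ F) :
    (∀ i, b i ∈ F) ∧ (∀ p q, C p q ∈ F) ∧ ∀ i, d i ∈ F := by
  obtain ⟨hU0, hU1⟩ := Matrix.inv_one_sub_strictUpper C hC
  have hdet := Matrix.det_one_sub_of_strictUpper C hC
  set U := (1 - C)⁻¹ with hU
  set W := latentCov C with hW_def
  have hWdef : W = U * Uᵀ := rfl
  have hoff : ∀ i j, i ≠ j → b i * b j * W (par i) (par j) ∈ F := fun i j hij => by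
    have := hS i j
    rwa [oneFactorCov, if_neg hij, add_zero] at this
  have hvar : ∀ i, b i * b i * W (par i) (par i) ∈ F := fun i => by
    obtain ⟨j, k, hji, hki, hjk, hj, hk⟩ := hsib i
    have h1 := hoff j k hjk
    have h2 := F.mul_mem (hoff i j hji.symm) (hoff i k hki.symm)
    rw [hj, hk] at h1 h2
    refine hdiv _ _ h1 (mul_ne_zero (mul_ne_zero (hb j) (hb k)) (hW _)) ?_
    convert h2 using 1
    ring
  obtain ⟨c, hc⟩ := hpar.hasRightInverse
  have hV : ∀ p q, b (c p) * U p q ∈ F := by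
    refine Matrix.upperTriangular_mem_of_mul_transpose_mem F hdiv hsq
      (Matrix.of fun p q => b (c p) * U p q) ?_ ?_ ?_
    · intro i j hij
      simp [hU0 i j hij]
    · intro i
      simp [hU1 i, hb]
    · intro p q
      have : (Matrix.of (fun p q => b (c p) * U p q) *
          (Matrix.of fun p q => b (c p) * U p q)ᵀ) p q = b (c p) * b (c q) * W p q := by
        simp only [hWdef, Matrix.mul_apply, Matrix.transpose_apply, Matrix.of_apply,
          Finset.mul_sum]
        exact Finset.sum_congr rfl fun _ _ => by ring
      rw [this]
      by_cases hpq : p = q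
      · subst hpq
        have := hvar (c p)
        rwa [hc p] at this
      · have := hoff (c p) (c q) fun h => hpq (by rw [← hc p, ← hc q, h])
        rwa [hc p, hc q] at this
  have hbc : ∀ p, b (c p) ∈ F := fun p => by
    have := hV p p
    rwa [hU1, mul_one] at this
  have hUF : ∀ p q, U p q ∈ F := fun p q => hdiv _ _ (hbc p) (hb _) (hV p q)
  refine ⟨fun i => ?_, fun p q => ?_, fun i => ?_⟩
  · by_cases h : c (par i) = i
    · rw [← h]
      exact hbc _
    · have h1 := hoff (c (par i)) i h
      rw [hc] at h1
      have hWF : W (par i) (par i) ∈ F := by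
        rw [hWdef, Matrix.mul_apply]
        exact F.sum_mem fun r _ => F.mul_mem (hUF _ _) (hUF _ _)
      refine hdiv _ _ (F.mul_mem (hbc (par i)) hWF) (mul_ne_zero (hb _) (hW _)) ?_
      convert h1 using 1
      ring
  · have hinv : U⁻¹ = 1 - C := Matrix.nonsing_inv_nonsing_inv _ (by simp [hdet])
    have hUdet : U.det = 1 := by
      rw [hU, Matrix.det_nonsing_inv, hdet, Ring.inverse_one]
    have h1 := Matrix.inv_mem_of_mem F U hUdet hUF p q
    rw [hinv, Matrix.sub_apply] at h1
    have h2 : (1 : Matrix (Fin n) (Fin n) P) p q ∈ F := by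
      rw [Matrix.one_apply]
      split_ifs
      exacts [F.one_mem, F.zero_mem]
    simpa using F.sub_mem h2 h1
  · have h1 := F.sub_mem (hS i i) (hvar i)
    simpa [oneFactorCov, hW_def] using h1

/-- Parameters of a normalized 1-factor model: a loading for each measured variable, a coefficient
for each edge among latents, and a noise variance for each measured variable. -/
abbrev Pattern.Param {m n : ℕ} (G : Pattern m n) : Type :=
  Fin m ⊕ {e : Fin n × Fin n // G.C e.1 e.2 ≠ 0} ⊕ Fin m

/-- The matrix of latent edge coefficients given by a parameter vector. -/
def Pattern.latentCoeff {m n : ℕ} (G : Pattern m n) {R : Type*} [CommRing R] (θ : G.Param → R) :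
    Matrix (Fin n) (Fin n) R :=
  fun p q => if h : G.C p q ≠ 0 then θ (.inr (.inl ⟨(p, q), h⟩)) else 0

/-- The measured covariance matrix given by a parameter vector. -/
def Pattern.paramCov {m n : ℕ} (G : Pattern m n) (par : Fin m → Fin n) {R : Type*} [CommRing R]
    (θ : G.Param → R) : Matrix (Fin m) (Fin m) R :=
  oneFactorCov par (fun i => θ (.inl i)) (G.latentCoeff θ) fun i => θ (.inr (.inr i))

theorem Pattern.latentCoeff_strictUpper {m n : ℕ} (G : Pattern m n) {R : Type*} [CommRing R]
    (θ : G.Param → R) (i j : Fin n) (h : j ≤ i) : G.latentCoeff θ i j = 0 := by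
  simp [Pattern.latentCoeff, G.hCstrict i j h]

theorem Pattern.map_paramCov {m n : ℕ} (G : Pattern m n) (par : Fin m → Fin n) {R S : Type*}
    [CommRing R] [CommRing S] (f : R →+* S) (θ : G.Param → R) (i j : Fin m) :
    f (G.paramCov par θ i j) = G.paramCov par (fun a => f (θ a)) i j := by
  rw [Pattern.paramCov, oneFactorCov_map f _ _ _ (G.latentCoeff_strictUpper θ)]
  congr 1
  ext p q
  simp only [Pattern.latentCoeff, Matrix.map_apply]
  split_ifs <;> simp

theorem mul_mul_transpose_apply_of_single {m n : ℕ} (par : Fin m → Fin n)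
    (B : Matrix (Fin m) (Fin n) ℝ) (hB : ∀ i j, par i ≠ j → B i j = 0)
    (M : Matrix (Fin n) (Fin n) ℝ) (i j : Fin m) :
    (B * M * Bᵀ) i j = B i (par i) * B j (par j) * M (par i) (par j) := by
  rw [Matrix.mul_apply, Finset.sum_eq_single (par j), Matrix.mul_apply,
    Finset.sum_eq_single (par i), Matrix.transpose_apply]
  · ring
  · intro p _ hp
    simp [hB i p hp.symm]
  · simp
  · intro p _ hp
    simp [hB j p hp.symm]
  · simp

theorem latentCov_rescale {n : ℕ} (C : Matrix (Fin n) (Fin n) ℝ) (hC : ∀ i j, j ≤ i → C i j = 0)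
    (s : Fin n → ℝ) (hs : ∀ i, s i ≠ 0) (p q : Fin n) :
    s p * s q * latentCov (Matrix.of fun i j => (s i)⁻¹ * C i j * s j) p q =
      ((1 - C)⁻¹ * Matrix.diagonal (fun i => s i * s i) * ((1 - C)⁻¹)ᵀ :
        Matrix (Fin n) (Fin n) ℝ) p q := by
  have hdet := Matrix.det_one_sub_of_strictUpper C hC
  have hss : (Matrix.diagonal s * Matrix.diagonal fun i => (s i)⁻¹) = 1 := by
    simp [Matrix.diagonal_mul_diagonal, hs]
  have hss' : ((Matrix.diagonal fun i => (s i)⁻¹) * Matrix.diagonal s) = 1 := by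
    simp [Matrix.diagonal_mul_diagonal, hs]
  have hC' : (1 - Matrix.of fun i j => (s i)⁻¹ * C i j * s j) =
      (Matrix.diagonal fun i => (s i)⁻¹) * (1 - C) * Matrix.diagonal s := by
    rw [Matrix.mul_sub, Matrix.sub_mul, Matrix.mul_one, hss']
    congr 1
    ext i j
    simp [Matrix.mul_diagonal, Matrix.diagonal_mul]
  have hinv : (1 - Matrix.of fun i j => (s i)⁻¹ * C i j * s j)⁻¹ =
      (Matrix.diagonal fun i => (s i)⁻¹) * (1 - C)⁻¹ * Matrix.diagonal s := by
    refine Matrix.inv_eq_left_inv ?_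
    rw [hC']
    calc _ = (Matrix.diagonal fun i => (s i)⁻¹) * ((1 - C)⁻¹ * ((Matrix.diagonal s *
          Matrix.diagonal fun i => (s i)⁻¹) * (1 - C))) * Matrix.diagonal s := by
          simp only [Matrix.mul_assoc]
      _ = 1 := by
          rw [hss, Matrix.one_mul, Matrix.nonsing_inv_mul _ (by simp [hdet]), Matrix.mul_one, hss']
  rw [latentCov, hinv]
  have := hs p
  have := hs q
  rw [Matrix.mul_apply, Matrix.mul_apply, Finset.mul_sum]
  refine Finset.sum_congr rfl fun r _ => ?_
  simp only [Matrix.mul_diagonal, Matrix.diagonal_mul, Matrix.transpose_apply]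
  field_simp

theorem Pattern.mem_distSet_iff {m n : ℕ} (G : Pattern m n) (par : Fin m → Fin n)
    (hpar : ∀ i j, G.B i j ≠ 0 ↔ par i = j) (Sx : Matrix (Fin m) (Fin m) ℝ) :
    Sx ∈ G.distSet ↔
      ∃ θ : G.Param → ℝ, (∀ i, 0 < θ (.inr (.inr i))) ∧ Sx = G.paramCov par θ := by
  have hpar0 : ∀ i j, G.B i j = 0 ↔ par i ≠ j := fun i j => by
    rw [ne_eq, ← hpar i j, not_not]
  constructor
  · rintro ⟨B, C, dX, dL, hB, hC, hCG, hdX, hdL, rfl⟩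
    have hs : ∀ i, √(dL i) ≠ 0 := fun i => (Real.sqrt_pos.mpr (hdL i)).ne'
    refine ⟨Sum.elim (fun i => B i (par i) * √(dL (par i)))
      (Sum.elim (fun e => (√(dL e.1.1))⁻¹ * C e.1.1 e.1.2 * √(dL e.1.2)) dX), hdX, ?_⟩
    have hC' : G.latentCoeff (Sum.elim (fun i => B i (par i) * √(dL (par i)))
        (Sum.elim (fun e => (√(dL e.1.1))⁻¹ * C e.1.1 e.1.2 * √(dL e.1.2)) dX)) =
        Matrix.of fun i j => (√(dL i))⁻¹ * C i j * √(dL j) := by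
      ext p q
      by_cases h : G.C p q = 0
      · simp [Pattern.latentCoeff, h, hCG p q h]
      · simp [Pattern.latentCoeff, h]
    have hdL' : Matrix.diagonal dL = Matrix.diagonal fun i => √(dL i) * √(dL i) := by
      congr 1
      ext i
      rw [Real.mul_self_sqrt (hdL i).le]
    ext i j
    have h1 := mul_mul_transpose_apply_of_single par B (fun i j h => hB i j ((hpar0 i j).mpr h))
      ((1 - C)⁻¹ * Matrix.diagonal dL * ((1 - C)⁻¹)ᵀ) i j
    have h2 := latentCov_rescale C hC (fun i => √(dL i)) hs (par i) (par j)
    rw [← hdL'] at h2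
    rw [← h2] at h1
    simp only [← Matrix.mul_assoc] at h1
    rw [Matrix.add_apply, h1, Pattern.paramCov, hC', oneFactorCov, Matrix.diagonal_apply]
    simp only [Sum.elim_inl, Sum.elim_inr]
    ring
  · rintro ⟨θ, hθ, rfl⟩
    refine ⟨Matrix.of fun i j => if par i = j then θ (.inl i) else 0, G.latentCoeff θ,
      fun i => θ (.inr (.inr i)), fun _ => 1, ?_, G.latentCoeff_strictUpper θ, ?_, hθ,
      fun _ => one_pos, ?_⟩
    · intro i j h
      simp [(hpar0 i j).mp h]
    · intro i j h
      simp [Pattern.latentCoeff, h]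
    · ext i j
      have h1 := mul_mul_transpose_apply_of_single par
        (Matrix.of fun i j => if par i = j then θ (.inl i) else 0)
        (fun i j h => by simp [h]) (latentCov (G.latentCoeff θ)) i j
      simp only [latentCov, ← Matrix.mul_assoc] at h1
      rw [Matrix.diagonal_one, Matrix.mul_one, Matrix.add_apply, h1, Matrix.diagonal_apply]
      simp [Pattern.paramCov, oneFactorCov, latentCov]

theorem Pattern.exists_parent {m n : ℕ} (G : Pattern m n)
    (hRows : ∀ i : Fin m, (Finset.univ.filter fun j : Fin n => G.B i j ≠ 0).card = 1) :
    ∃ par : Fin m → Fin n, ∀ i j, G.B i j ≠ 0 ↔ par i = j := by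
  choose par hpar using fun i => Finset.card_eq_one.mp (hRows i)
  refine ⟨par, fun i j => ?_⟩
  have := Finset.ext_iff.mp (hpar i) j
  simp only [Finset.mem_filter, Finset.mem_univ, true_and, Finset.mem_singleton] at this
  rw [this, eq_comm]

theorem Pattern.card_param {m n : ℕ} (G : Pattern m n)
    (hRows : ∀ i : Fin m, (Finset.univ.filter fun j : Fin n => G.B i j ≠ 0).card = 1) :
    Fintype.card G.Param = G.edges + m := by
  have h : (Finset.univ.filter fun p : Fin m × Fin n => G.B p.1 p.2 ≠ 0).card = m := by
    simp only [Finset.card_filter] at hRows ⊢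
    rw [Fintype.sum_prod_type]
    simp only [hRows, Finset.sum_const, Finset.card_univ, Fintype.card_fin, smul_eq_mul, mul_one]
  rw [Pattern.edges, h, Fintype.card_sum, Fintype.card_sum, Fintype.card_fin,
    Fintype.card_subtype, add_assoc]

/-- The polynomial parametrization of the model, as a map of coordinate rings. -/
def Pattern.paramHom {m n : ℕ} (G : Pattern m n) (par : Fin m → Fin n) :
    MvPolynomial (Fin m × Fin m) ℝ →ₐ[ℝ] MvPolynomial G.Param ℝ :=
  MvPolynomial.aeval fun q => G.paramCov par MvPolynomial.X q.1 q.2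

theorem Pattern.eval_paramHom {m n : ℕ} (G : Pattern m n) (par : Fin m → Fin n)
    (θ : G.Param → ℝ) (p : MvPolynomial (Fin m × Fin m) ℝ) :
    MvPolynomial.eval θ (G.paramHom par p) =
      MvPolynomial.eval (fun q => G.paramCov par θ q.1 q.2) p := by
  induction p using MvPolynomial.induction_on with
  | C a => simp [Pattern.paramHom]
  | add p q hp hq => simp [hp, hq]
  | mul_X p q hp =>
    rw [map_mul, map_mul, hp, map_mul, MvPolynomial.eval_X, Pattern.paramHom,
      MvPolynomial.aeval_X, G.map_paramCov par (MvPolynomial.eval θ)]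
    simp

theorem Pattern.vanishingIdeal_eq_ker {m n : ℕ} (G : Pattern m n) (par : Fin m → Fin n)
    (hpar : ∀ i j, G.B i j ≠ 0 ↔ par i = j) :
    G.vanishingIdeal = RingHom.ker (G.paramHom par) := by
  ext p
  rw [RingHom.mem_ker]
  constructor
  · intro hp
    refine MvPolynomial.funext_set
      (Sum.elim (fun _ => Set.univ) (Sum.elim (fun _ => Set.univ) fun _ => Set.Ioi 0)) ?_ ?_
    · rintro (i | i | i)
      exacts [Set.infinite_univ, Set.infinite_univ, Set.Ioi_infinite 0]
    · intro θ hθ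
      rw [G.eval_paramHom, map_zero]
      exact hp _ ((G.mem_distSet_iff par hpar _).mpr
        ⟨θ, fun i => hθ (.inr (.inr i)) (Set.mem_univ _), rfl⟩)
  · intro hp Sx hSx
    obtain ⟨θ, -, rfl⟩ := (G.mem_distSet_iff par hpar _).mp hSx
    rw [← G.eval_paramHom, hp, map_zero]

theorem Pattern.latentCov_generic_ne_zero {m n : ℕ} (G : Pattern m n) (p : Fin n) :
    latentCov (G.latentCoeff (MvPolynomial.X : G.Param → MvPolynomial G.Param ℝ)) p p ≠ 0 := by
  intro h
  have hC := G.latentCoeff_strictUpper (MvPolynomial.X : G.Param → MvPolynomial G.Param ℝ)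
  obtain ⟨-, h1⟩ := Matrix.inv_one_sub_strictUpper _ hC
  have h2 := congrArg (MvPolynomial.eval (0 : G.Param → ℝ)) h
  rw [latentCov, Matrix.mul_apply, map_sum, map_zero,
    Finset.sum_eq_zero_iff_of_nonneg fun q _ => by simp [mul_self_nonneg]] at h2
  simpa [h1] using h2 p (Finset.mem_univ p)

theorem Pattern.exists_siblings {m n : ℕ} (G : Pattern m n) (par : Fin m → Fin n)
    (hpar : ∀ i j, G.B i j ≠ 0 ↔ par i = j)
    (hCols : ∀ j : Fin n, 3 ≤ (Finset.univ.filter fun i : Fin m => G.B i j ≠ 0).card) (i : Fin m) :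
    ∃ j k, j ≠ i ∧ k ≠ i ∧ j ≠ k ∧ par j = par i ∧ par k = par i := by
  have h : 1 < ((Finset.univ.filter fun j : Fin m => G.B j (par i) ≠ 0).erase i).card := by
    have := Finset.pred_card_le_card_erase (a := i)
      (s := Finset.univ.filter fun j : Fin m => G.B j (par i) ≠ 0)
    have := hCols (par i)
    lia
  obtain ⟨j, hj, k, hk, hjk⟩ := Finset.one_lt_card.mp h
  simp only [Finset.mem_erase, Finset.mem_filter, Finset.mem_univ, true_and, hpar] at hj hk
  exact ⟨j, k, hj.1, hk.1, hjk, hj.2, hk.2⟩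

/-- **Proposition (degrees of freedom of 1-factor models).** If every measured variable has a
single latent parent (each row of `B_G` has exactly one nonzero entry) and every latent
variable has at least three measured children (each column of `B_G` has at least three
nonzero entries), then `dim(G) = |G| + m`. -/
theorem dim_one_factor {m n : ℕ} (G : Pattern m n)
    (hRows : ∀ i : Fin m, (Finset.univ.filter fun j : Fin n => G.B i j ≠ 0).card = 1)
    (hCols : ∀ j : Fin n, 3 ≤ (Finset.univ.filter fun i : Fin m => G.B i j ≠ 0).card) :
    G.dim = ((G.edges + m : ℕ) : WithBot ℕ∞) := by
  obtain ⟨par, hpar⟩ := G.exists_parent hRows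
  have hsurj : Function.Surjective par := fun j => by
    obtain ⟨i, hi⟩ := Finset.card_pos.mp (lt_of_lt_of_le (by norm_num) (hCols j))
    exact ⟨i, (hpar i j).mp (Finset.mem_filter.mp hi).2⟩
  rw [Pattern.dim, G.vanishingIdeal_eq_ker par hpar, ← G.card_param hRows]
  set φ := G.paramHom par with hφ
  let ψ := Ideal.kerLiftAlg φ
  have hψ : Function.Injective ψ := Ideal.kerLiftAlg_injective φ
  let _ := ψ.toRingHom.toAlgebra
  have : IsScalarTower ℝ (MvPolynomial (Fin m × Fin m) ℝ ⧸ RingHom.ker φ)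
    (MvPolynomial G.Param ℝ) := .of_algebraMap_eq' ψ.comp_algebraMap.symm
  have : FaithfulSMul (MvPolynomial (Fin m × Fin m) ℝ ⧸ RingHom.ker φ)
    (MvPolynomial G.Param ℝ) := (faithfulSMul_iff_algebraMap_injective _ _).mpr hψ
  have : IsDomain (MvPolynomial (Fin m × Fin m) ℝ ⧸ RingHom.ker φ) := hψ.isDomain
  let F := (Subalgebra.algebraicClosure (MvPolynomial (Fin m × Fin m) ℝ ⧸ RingHom.ker φ)
    (MvPolynomial G.Param ℝ)).toSubring
  obtain ⟨hb, hC, hd⟩ := mem_of_oneFactorCov_mem F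
    (fun x y hx hx0 hxy => IsAlgebraic.of_mul (mem_nonZeroDivisors_of_ne_zero hx0) hx hxy)
    (fun x hx => IsAlgebraic.of_pow two_pos (by rw [pow_two]; exact hx)) par hsurj
    (G.exists_siblings par hpar hCols) (fun i => MvPolynomial.X (.inl i))
    (G.latentCoeff MvPolynomial.X) (G.latentCoeff_strictUpper _)
    (fun i => MvPolynomial.X (.inr (.inr i))) (fun _ => MvPolynomial.X_ne_zero _)
    G.latentCov_generic_ne_zero (fun i j => by
      have h : φ (MvPolynomial.X (i, j)) = G.paramCov par MvPolynomial.X i j :=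
        MvPolynomial.aeval_X _ _
      change G.paramCov par MvPolynomial.X i j ∈ F
      rw [← h]
      exact isAlgebraic_algebraMap (Ideal.Quotient.mk _ (MvPolynomial.X (i, j))))
  have : Algebra.IsAlgebraic (MvPolynomial (Fin m × Fin m) ℝ ⧸ RingHom.ker φ)
      (MvPolynomial G.Param ℝ) := by
    refine ⟨fun x => ?_⟩
    change x ∈ F
    induction x using MvPolynomial.induction_on with
    | C a =>
      rw [← MvPolynomial.algebraMap_eq, IsScalarTower.algebraMap_apply ℝ
        (MvPolynomial (Fin m × Fin m) ℝ ⧸ RingHom.ker φ) (MvPolynomial G.Param ℝ)]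
      exact isAlgebraic_algebraMap _
    | add p q hp hq => exact F.add_mem hp hq
    | mul_X p a hp =>
      refine F.mul_mem hp ?_
      rcases a with i | ⟨⟨p, q⟩, h⟩ | i
      · exact hb i
      · simpa [Pattern.latentCoeff, h] using hC p q
      · exact hd i
  exact ringKrullDim_eq_of_mvPolynomial_isAlgebraic (k := ℝ)

end
end

section
/- Proposition (reduced dimension): Let G be a pattern with m measured and n latent variables. Suppose there is a set S of latent indices with |S| = k ≥ 2 such that all indices j ∈ S have identical columns in B_G, identical columns in C_G, and identical rows in C_G (i.e., the latent variables indexed by S have the same set of parents and the same set of children), and suppose that either the common number of children (the number of nonzero entries in the common column of B_G plus the number of nonzero entries in the common column of C_G) is at least k, or the common number of parents (the number of nonzero entries in the common row of C_G) is at least k. Then dim(G) ≤ |G| + m − k(k−1)/2. -/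
open Matrix

noncomputable section

/-- The number of children of latent index `j`: measured children (nonzero entries in column
`j` of `B_G`) plus latent children (nonzero entries in column `j` of `C_G`). -/
def Pattern.childCount {m n : ℕ} (G : Pattern m n) (j : Fin n) : ℕ :=
  (Finset.univ.filter fun i : Fin m => G.B i j ≠ 0).card +
  (Finset.univ.filter fun i : Fin n => G.C i j ≠ 0).card

/-- The number of parents of latent index `j`: nonzero entries in row `j` of `C_G`. -/
def Pattern.parentCount {m n : ℕ} (G : Pattern m n) (j : Fin n) : ℕ :=
  (Finset.univ.filter fun i : Fin n => G.C j i ≠ 0).card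

/-! ### Krull dimension of images of polynomial maps -/

theorem ringKrullDim_le_of_isIntegral {R A : Type*} [CommRing R] [CommRing A]
    (g : R →+* A) (hg : g.IsIntegral) : ringKrullDim A ≤ ringKrullDim R := by
  let _ : Algebra R A := g.toAlgebra
  have : Algebra.IsIntegral R A := ⟨hg⟩
  refine Order.krullDim_le_of_strictMono (PrimeSpectrum.comap (algebraMap R A)) ?_
  intro I J hIJ
  exact Ideal.IsIntegral.comap_lt_comap (R := R) (I := I.asIdeal) (J := J.asIdeal) hIJ

theorem MvPolynomial.ringKrullDim_quotient_le_of_ker_le {K σ τ : Type} [Field K] [Finite σ]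
    [Fintype τ] (ψ : MvPolynomial σ K →ₐ[K] MvPolynomial τ K) (I : Ideal (MvPolynomial σ K))
    (hI : RingHom.ker ψ ≤ I) :
    ringKrullDim (MvPolynomial σ K ⧸ I) ≤ (Fintype.card τ : ℕ) := by
  have : Nontrivial (MvPolynomial σ K ⧸ RingHom.ker ψ) :=
    Ideal.Quotient.nontrivial_iff.mpr (RingHom.ker_ne_top _)
  obtain ⟨s, g, hg, hint⟩ := exists_integral_inj_algHom_of_fg K (MvPolynomial σ K ⧸ RingHom.ker ψ)
  have hs : s ≤ Fintype.card τ := by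
    have h := trdeg_le_of_injective ((Ideal.kerLiftAlg ψ).comp g)
      ((Ideal.kerLiftAlg_injective ψ).comp hg)
    simpa [MvPolynomial.trdeg_of_isDomain] using h
  calc ringKrullDim (MvPolynomial σ K ⧸ I)
      ≤ ringKrullDim (MvPolynomial σ K ⧸ RingHom.ker ψ) :=
        ringKrullDim_le_of_surjective (Ideal.Quotient.factor hI)
          (Ideal.Quotient.factor_surjective hI)
    _ ≤ ringKrullDim (MvPolynomial (Fin s) K) :=
        ringKrullDim_le_of_isIntegral g.toRingHom hint
    _ = (s : ℕ) := by simp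
    _ ≤ (Fintype.card τ : ℕ) := by exact_mod_cast hs

/-! ### The covariance matrix with unit latent variances -/

section FactorCov

variable {m n : ℕ} {R : Type*} [CommRing R]

/-- The covariance matrix of the coefficient matrix `E`, whose upper rows are the edges to
measured variables and whose lower rows are the edges among latent variables, with unit latent
variances and measured noise variances `d`. -/
def factorCov (E : Matrix (Fin m ⊕ Fin n) (Fin n) R) (d : Fin m → R) :
    Matrix (Fin m) (Fin m) R :=
  (E.toRows₁ * (1 - E.toRows₂).adjugate) * (E.toRows₁ * (1 - E.toRows₂).adjugate)ᵀ + diagonal d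

theorem factorCov_map {R' : Type*} [CommRing R'] (f : R →+* R')
    (E : Matrix (Fin m ⊕ Fin n) (Fin n) R) (d : Fin m → R) :
    (factorCov E d).map f = factorCov (E.map f) (f ∘ d) := by
  have hadj : ((1 - E.toRows₂).adjugate).map f = (1 - (E.map f).toRows₂).adjugate := by
    have h := RingHom.map_adjugate f (1 - E.toRows₂)
    rw [map_sub, map_one] at h
    exact h
  have hN : (E.toRows₁ * (1 - E.toRows₂).adjugate).map f =
      (E.map f).toRows₁ * (1 - (E.map f).toRows₂).adjugate := by
    rw [Matrix.map_mul, hadj]; rfl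
  rw [factorCov, Matrix.map_add f (map_add f), Matrix.map_mul, transpose_map, hN,
    diagonal_map (map_zero f)]
  rfl

/-- Change of coordinates on the latent variables. -/
def changeLatent (E : Matrix (Fin m ⊕ Fin n) (Fin n) R) (T T' : Matrix (Fin n) (Fin n) R) :
    Matrix (Fin m ⊕ Fin n) (Fin n) R :=
  fromRows (E.toRows₁ * T) (T' * E.toRows₂ * T)

theorem mul_adjugate_changeLatent (E : Matrix (Fin m ⊕ Fin n) (Fin n) R)
    {T T' : Matrix (Fin n) (Fin n) R} (hT : T' * T = 1) :
    (changeLatent E T T').toRows₁ * (1 - (changeLatent E T T').toRows₂).adjugate =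
      E.toRows₁ * (1 - E.toRows₂).adjugate * T := by
  have hdet : T'.det * T.det = 1 := by rw [← det_mul, hT, det_one]
  have hsim : 1 - T' * E.toRows₂ * T = T' * (1 - E.toRows₂) * T := by
    rw [Matrix.mul_sub, Matrix.sub_mul, Matrix.mul_one, hT]
  have hadj : T'.adjugate = T'.det • T := by
    calc T'.adjugate = T'.adjugate * (T' * T) := by rw [hT, Matrix.mul_one]
      _ = T'.det • T := by rw [← Matrix.mul_assoc, adjugate_mul, smul_mul, Matrix.one_mul]
  simp only [changeLatent, toRows₁_fromRows, toRows₂_fromRows]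
  rw [hsim, adjugate_mul_distrib, adjugate_mul_distrib, hadj]
  calc E.toRows₁ * T * (T.adjugate * ((1 - E.toRows₂).adjugate * T'.det • T))
      = E.toRows₁ * (T * T.adjugate) * ((1 - E.toRows₂).adjugate * T'.det • T) := by
        simp only [Matrix.mul_assoc]
    _ = (T'.det * T.det) • (E.toRows₁ * (1 - E.toRows₂).adjugate * T) := by
        rw [mul_adjugate]
        simp [Matrix.mul_assoc, smul_smul]
    _ = _ := by rw [hdet, one_smul]

theorem factorCov_changeLatent (E : Matrix (Fin m ⊕ Fin n) (Fin n) R) (d : Fin m → R)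
    {Q : Matrix (Fin n) (Fin n) R} (hQ : Qᵀ * Q = 1) :
    factorCov (changeLatent E Q Qᵀ) d = factorCov E d := by
  have hQ' : Q * Qᵀ = 1 := mul_eq_one_comm.mp hQ
  rw [factorCov, mul_adjugate_changeLatent E hQ, factorCov]
  set N := E.toRows₁ * (1 - E.toRows₂).adjugate
  rw [transpose_mul, Matrix.mul_assoc, ← Matrix.mul_assoc Q, hQ', Matrix.one_mul]

end FactorCov

namespace Pattern

variable {m n : ℕ} (G : Pattern m n)

/-- The adjacency matrix of a pattern, recording the edges to all vertices. -/
def adj : Matrix (Fin m ⊕ Fin n) (Fin n) ℕ := fromRows G.B G.C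

/-- The finite set of edges of a pattern. -/
def edgeFinset : Finset ((Fin m ⊕ Fin n) × Fin n) :=
  Finset.univ.filter fun p => G.adj p.1 p.2 ≠ 0

theorem card_edgeFinset : G.edgeFinset.card = G.edges := by
  rw [edgeFinset, edges]
  simp_rw [Finset.card_filter, Fintype.sum_prod_type]
  rw [Fintype.sum_sum_type]
  rfl

theorem card_children (j : Fin n) :
    Fintype.card {v // G.adj v j ≠ 0} = G.childCount j := by
  rw [Fintype.card_subtype]
  rw [childCount]
  simp_rw [Finset.card_filter]
  rw [Fintype.sum_sum_type]
  rfl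

theorem dim_le_card_add (P : Finset ((Fin m ⊕ Fin n) × Fin n))
    (h : ∀ Sx ∈ G.distSet, ∃ (E : Matrix (Fin m ⊕ Fin n) (Fin n) ℝ) (d : Fin m → ℝ),
      (∀ v j, (v, j) ∉ P → E v j = 0) ∧ Sx = factorCov E d) :
    G.dim ≤ ((P.card + m : ℕ) : WithBot ℕ∞) := by
  classical
  let E₀ : Matrix (Fin m ⊕ Fin n) (Fin n) (MvPolynomial (P ⊕ Fin m) ℝ) :=
    of fun v j => if hv : (v, j) ∈ P then MvPolynomial.X (Sum.inl ⟨(v, j), hv⟩) else 0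
  let d₀ : Fin m → MvPolynomial (P ⊕ Fin m) ℝ := fun i => MvPolynomial.X (Sum.inr i)
  let ψ : MvPolynomial (Fin m × Fin m) ℝ →ₐ[ℝ] MvPolynomial (P ⊕ Fin m) ℝ :=
    MvPolynomial.aeval fun q => factorCov E₀ d₀ q.1 q.2
  have hψ : RingHom.ker ψ ≤ G.vanishingIdeal := by
    intro p hp Sx hSx
    obtain ⟨E, d, hE, rfl⟩ := h Sx hSx
    let x : P ⊕ Fin m → ℝ := Sum.elim (fun e => E e.1.1 e.1.2) d
    have hE₀ : E₀.map (MvPolynomial.eval x) = E := by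
      ext v j
      by_cases hv : (v, j) ∈ P
      · simp [E₀, hv, x]
      · simp [E₀, hv, hE v j hv]
    have hd₀ : MvPolynomial.eval x ∘ d₀ = d := by
      ext i; simp [d₀, x]
    have hS : factorCov E d = (factorCov E₀ d₀).map (MvPolynomial.eval x) := by
      rw [factorCov_map, hE₀, hd₀]
    have hcomp : MvPolynomial.eval (fun q : Fin m × Fin m => factorCov E d q.1 q.2) p =
        MvPolynomial.eval x (ψ p) := by
      have hev : (MvPolynomial.aeval x).comp ψ =
          MvPolynomial.aeval fun q : Fin m × Fin m => factorCov E d q.1 q.2 := by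
        ext q
        simp [ψ, hS]
      have h := DFunLike.congr_fun hev p
      simpa [MvPolynomial.coe_aeval_eq_eval] using h.symm
    rw [hcomp, RingHom.mem_ker.mp hp, map_zero]
  have hdim := MvPolynomial.ringKrullDim_quotient_le_of_ker_le ψ _ hψ
  simpa [dim] using hdim

theorem exists_factorCov_of_mem_distSet {Sx : Matrix (Fin m) (Fin m) ℝ} (hSx : Sx ∈ G.distSet) :
    ∃ (E : Matrix (Fin m ⊕ Fin n) (Fin n) ℝ) (d : Fin m → ℝ),
      (∀ v j, G.adj v j = 0 → E v j = 0) ∧ Sx = factorCov E d := by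
  obtain ⟨B, C, dX, dL, hB, hCu, hC, -, hL, rfl⟩ := hSx
  let D : Matrix (Fin n) (Fin n) ℝ := diagonal fun i => √(dL i)
  let D' : Matrix (Fin n) (Fin n) ℝ := diagonal fun i => (√(dL i))⁻¹
  have hD : D' * D = 1 := by
    simp only [D, D', diagonal_mul_diagonal, ← diagonal_one]
    congr 1; ext i
    exact inv_mul_cancel₀ (Real.sqrt_pos.mpr (hL i)).ne'
  have hDD : D * Dᵀ = diagonal dL := by
    simp only [D, diagonal_transpose, diagonal_mul_diagonal]
    congr 1; ext i
    exact Real.mul_self_sqrt (hL i).le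
  have hdet : (1 - C).det = 1 := by
    rw [det_of_isUpperTriangular]
    · simp [hCu]
    · intro i j hij
      have hij' : j < i := hij
      simp [hCu i j hij'.le, hij'.ne']
  have hinv : (1 - C)⁻¹ = (1 - C).adjugate := by simp [inv_def, hdet]
  refine ⟨changeLatent (fromRows B C) D D', dX, ?_, ?_⟩
  · rintro (i | i) j h
    · simp [changeLatent, D, hB i j h]
    · simp [changeLatent, D, D', hC i j h]
  · rw [factorCov, mul_adjugate_changeLatent _ hD]
    simp only [toRows₁_fromRows, toRows₂_fromRows, transpose_mul, hinv, ← hDD, Matrix.mul_assoc]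

end Pattern

/-! ### Rotating a set of latent variables -/

/-- The matrix `Q` is diagonal except for its block with rows and columns in `S`. -/
def ActsWithin {ι R : Type*} [Zero R] (S : Set ι) (Q : Matrix ι ι R) : Prop :=
  ∀ i j, Q i j ≠ 0 → i = j ∨ (i ∈ S ∧ j ∈ S)

theorem exists_orthogonal_triangular {k : ℕ} (A : Matrix (Fin k) (Fin k) ℝ) :
    ∃ Q : Matrix (Fin k) (Fin k) ℝ, Qᵀ * Q = 1 ∧ ∀ a b, a < b → (A * Q) a b = 0 := by
  let f : Fin k → EuclideanSpace ℝ (Fin k) := fun a => WithLp.toLp 2 (A a)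
  let e := InnerProductSpace.gramSchmidtOrthonormalBasis (𝕜 := ℝ) (by simp) f
  refine ⟨of fun a b => e b a, ?_, fun a b hab => ?_⟩
  · ext a b
    have h := orthonormal_iff_ite.mp e.orthonormal a b
    simpa [mul_apply, one_apply, PiLp.inner_apply, mul_comm] using h
  · have h := InnerProductSpace.gramSchmidtOrthonormalBasis_inv_triangular (𝕜 := ℝ) (by simp) f hab
    simpa [mul_apply, PiLp.inner_apply, f, e] using h

theorem exists_orthogonal_actsWithin {n k : ℕ} (s : Fin k ↪ Fin n)
    (A : Matrix (Fin k) (Fin n) ℝ) :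
    ∃ Q : Matrix (Fin n) (Fin n) ℝ, Qᵀ * Q = 1 ∧ ActsWithin (Set.range s) Q ∧
      ∀ a b, a < b → (A * Q) a (s b) = 0 := by
  let J : Matrix (Fin n) (Fin k) ℝ := of fun i a => if i = s a then 1 else 0
  have hJ : Jᵀ * J = 1 := by
    ext a b
    simp [J, mul_apply, one_apply, s.injective.eq_iff, eq_comm]
  obtain ⟨q, hq, hAq⟩ := exists_orthogonal_triangular (A * J)
  have hJ' : ∀ X : Matrix (Fin k) (Fin n) ℝ, Jᵀ * (J * X) = X := fun X => by
    rw [← Matrix.mul_assoc, hJ, Matrix.one_mul]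
  refine ⟨1 + J * (q - 1) * Jᵀ, ?_, ?_, fun a b hab => ?_⟩
  · have hsum : (qᵀ - 1) + (q - 1) + (qᵀ - 1) * (q - 1) = 0 := by
      rw [sub_mul, mul_sub, mul_sub, hq]
      simp
    calc (1 + J * (q - 1) * Jᵀ)ᵀ * (1 + J * (q - 1) * Jᵀ)
        = 1 + J * ((qᵀ - 1) + (q - 1) + (qᵀ - 1) * (q - 1)) * Jᵀ := by
          simp only [transpose_add, transpose_mul, transpose_one, transpose_transpose,
            transpose_sub, Matrix.add_mul, Matrix.mul_add, Matrix.one_mul, Matrix.mul_one,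
            Matrix.mul_assoc, hJ']
          abel
      _ = 1 := by rw [hsum]; simp
  · intro i j hij
    by_cases h : i = j
    · exact Or.inl h
    · right
      rw [Matrix.add_apply, one_apply_ne h, zero_add, mul_apply] at hij
      simp only [mul_apply (M := J)] at hij
      obtain ⟨a, -, ha⟩ := Finset.exists_ne_zero_of_sum_ne_zero hij
      obtain ⟨b, -, hb⟩ := Finset.exists_ne_zero_of_sum_ne_zero (left_ne_zero_of_mul ha)
      have h1 : J i b ≠ 0 := left_ne_zero_of_mul hb
      have h2 : J j a ≠ 0 := right_ne_zero_of_mul ha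
      simp only [J, of_apply, ne_eq, ite_eq_right_iff, one_ne_zero, imp_false, not_not] at h1 h2
      exact ⟨⟨b, h1.symm⟩, ⟨a, h2.symm⟩⟩
  · have hcol : ∀ M : Matrix (Fin k) (Fin n) ℝ, M a (s b) = (M * J) a b := fun M => by
      simp [J, mul_apply]
    rw [hcol (A * (1 + J * (q - 1) * Jᵀ))]
    have : A * (1 + J * (q - 1) * Jᵀ) * J = A * J * q := by
      simp only [Matrix.mul_assoc, Matrix.add_mul, hJ, Matrix.mul_add, Matrix.mul_sub,
        Matrix.mul_one]
      abel
    rw [this, hAq a b hab]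

theorem ActsWithin.mul_right_eq_zero {ι κ : Type*} [Fintype ι] {S : Set ι}
    {Q : Matrix ι ι ℝ} (hQ : ActsWithin S Q) {M : Matrix κ ι ℝ} {p : κ → ι → ℕ}
    (hp : ∀ j₁ ∈ S, ∀ j₂ ∈ S, ∀ v, p v j₁ = p v j₂) (hM : ∀ v j, p v j = 0 → M v j = 0)
    (v : κ) (j : ι) (h : p v j = 0) : (M * Q) v j = 0 := by
  refine Finset.sum_eq_zero fun l _ => ?_
  by_cases hl : Q l j = 0
  · simp [hl]
  · rcases hQ l j hl with rfl | ⟨hl, hj⟩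
    · simp [hM _ _ h]
    · simp [hM v l ((hp l hl j hj v).trans h)]

theorem ActsWithin.mul_apply_of_notMem {ι κ : Type*} [Fintype ι] {S : Set ι}
    {Q : Matrix ι ι ℝ} (hQ : ActsWithin S Q) (M : Matrix κ ι ℝ) (v : κ) {j : ι} (hj : j ∉ S) :
    (M * Q) v j = M v j * Q j j := by
  rw [mul_apply]
  refine Fintype.sum_eq_single j fun l hlj => by_contra fun hl => hlj ?_
  exact (hQ l j (right_ne_zero_of_mul hl)).resolve_right fun h => hj h.2

theorem card_filter_lt (k : ℕ) :
    (Finset.univ.filter fun p : Fin k × Fin k => p.1 < p.2).card = k * (k - 1) / 2 := by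
  rw [Finset.card_filter, Fintype.sum_prod_type_right]
  simp only [← Finset.card_filter]
  rw [← Finset.sum_range_id, ← Fin.sum_univ_eq_sum_range (fun i => i)]
  refine Finset.sum_congr rfl fun b _ => ?_
  rw [← Fin.card_Iio b]
  congr 1; ext a; simp

namespace Pattern

variable {m n : ℕ} (G : Pattern m n)

theorem changeLatent_eq_zero {S : Set (Fin n)}
    (hcols : ∀ j₁ ∈ S, ∀ j₂ ∈ S, ∀ v, G.adj v j₁ = G.adj v j₂)
    (hrows : ∀ j₁ ∈ S, ∀ j₂ ∈ S, ∀ i, G.C j₁ i = G.C j₂ i)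
    {E : Matrix (Fin m ⊕ Fin n) (Fin n) ℝ} (hE : ∀ v j, G.adj v j = 0 → E v j = 0)
    {Q : Matrix (Fin n) (Fin n) ℝ} (hQ : ActsWithin S Q)
    (v : Fin m ⊕ Fin n) (j : Fin n) (h : G.adj v j = 0) : changeLatent E Q Qᵀ v j = 0 := by
  have hEQ := hQ.mul_right_eq_zero hcols hE
  rcases v with i | i
  · exact hEQ (Sum.inl i) j h
  · have hCQ := hQ.mul_right_eq_zero (M := (E.toRows₂ * Q)ᵀ) (p := fun j i => G.C i j)
      (fun j₁ h₁ j₂ h₂ v => hrows j₁ h₁ j₂ h₂ v) (fun j i h => hEQ (Sum.inr i) j h) j i h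
    rw [changeLatent, fromRows_apply_inr, Matrix.mul_assoc, ← transpose_apply (Qᵀ * _),
      transpose_mul, transpose_transpose]
    exact hCQ

theorem dim_le_of_forall_exists_rotation {S : Set (Fin n)} {k : ℕ}
    (hcols : ∀ j₁ ∈ S, ∀ j₂ ∈ S, ∀ v, G.adj v j₁ = G.adj v j₂)
    (hrows : ∀ j₁ ∈ S, ∀ j₂ ∈ S, ∀ i, G.C j₁ i = G.C j₂ i)
    (f : Fin k × Fin k → (Fin m ⊕ Fin n) × Fin n) (hf : Function.Injective f)
    (hfG : ∀ p, G.adj (f p).1 (f p).2 ≠ 0)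
    (h : ∀ E : Matrix (Fin m ⊕ Fin n) (Fin n) ℝ,
      ∃ Q : Matrix (Fin n) (Fin n) ℝ, Qᵀ * Q = 1 ∧ ActsWithin S Q ∧
        ∀ p : Fin k × Fin k, p.1 < p.2 → changeLatent E Q Qᵀ (f p).1 (f p).2 = 0) :
    G.dim ≤ ((G.edges + m - k * (k - 1) / 2 : ℕ) : WithBot ℕ∞) := by
  classical
  let Z := (Finset.univ.filter fun p : Fin k × Fin k => p.1 < p.2).image f
  have hZ : Z.card = k * (k - 1) / 2 := by
    rw [Finset.card_image_of_injective _ hf, card_filter_lt]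
  have hZG : Z ⊆ G.edgeFinset := by
    intro e he
    obtain ⟨p, -, rfl⟩ := Finset.mem_image.mp he
    simpa [edgeFinset] using hfG p
  have hle := Finset.card_le_card hZG
  have hcard : (G.edgeFinset \ Z).card + m = G.edges + m - k * (k - 1) / 2 := by
    rw [Finset.card_sdiff_of_subset hZG, hZ, card_edgeFinset]
    rw [hZ, card_edgeFinset] at hle
    omega
  rw [← hcard]
  refine G.dim_le_card_add _ fun Sx hSx => ?_
  obtain ⟨E, d, hE, rfl⟩ := G.exists_factorCov_of_mem_distSet hSx
  obtain ⟨Q, hQ, hS, h0⟩ := h E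
  refine ⟨changeLatent E Q Qᵀ, d, fun v j hv => ?_, (factorCov_changeLatent E d hQ).symm⟩
  by_cases hvj : G.adj v j = 0
  · exact G.changeLatent_eq_zero hcols hrows hE hS v j hvj
  · have hvZ : (v, j) ∈ Z := by
      by_contra hvZ
      exact hv (by simp [edgeFinset, hvj, hvZ])
    obtain ⟨p, hp, hpv⟩ := Finset.mem_image.mp hvZ
    simpa [hpv] using h0 p (by simpa using hp)

end Pattern

/-- **Proposition (reduced dimension).** If `k ≥ 2` latent variables have the same set of
parents and the same set of children, and the common number of children or the common number
of parents is at least `k`, then `dim(G) ≤ |G| + m − k(k−1)/2`. -/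
theorem dim_reduced {m n : ℕ} (G : Pattern m n) (S : Finset (Fin n)) (k : ℕ)
    (hk : 2 ≤ k) (hcard : S.card = k)
    (hBcols : ∀ j₁ ∈ S, ∀ j₂ ∈ S, ∀ i : Fin m, G.B i j₁ = G.B i j₂)
    (hCcols : ∀ j₁ ∈ S, ∀ j₂ ∈ S, ∀ i : Fin n, G.C i j₁ = G.C i j₂)
    (hCrows : ∀ j₁ ∈ S, ∀ j₂ ∈ S, ∀ i : Fin n, G.C j₁ i = G.C j₂ i)
    (hcount : (∀ j ∈ S, k ≤ G.childCount j) ∨ (∀ j ∈ S, k ≤ G.parentCount j)) :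
    G.dim ≤ ((G.edges + m - k * (k - 1) / 2 : ℕ) : WithBot ℕ∞) := by
  let s : Fin k ↪ Fin n := (S.orderEmbOfFin hcard).toEmbedding
  have hs : Set.range s = (S : Set (Fin n)) := S.range_orderEmbOfFin hcard
  have hsS : ∀ a, s a ∈ S := fun a => S.orderEmbOfFin_mem hcard a
  have hcols : ∀ j₁ ∈ (S : Set (Fin n)), ∀ j₂ ∈ (S : Set (Fin n)), ∀ v,
      G.adj v j₁ = G.adj v j₂ := by
    rintro j₁ h₁ j₂ h₂ (i | i)
    · exact hBcols j₁ h₁ j₂ h₂ i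
    · exact hCcols j₁ h₁ j₂ h₂ i
  have hCzero : ∀ i ∈ S, ∀ j ∈ S, G.C i j = 0 := fun i hi j hj => by
    rw [hCcols j hj i hi i, G.hCstrict i i le_rfl]
  let j₀ : Fin n := s ⟨0, by omega⟩
  have hj₀ : j₀ ∈ S := hsS _
  rcases hcount with hcount | hcount
  · have hle : Fintype.card (Fin k) ≤ Fintype.card {v // G.adj v j₀ ≠ 0} := by
      rw [G.card_children, Fintype.card_fin]
      exact hcount j₀ hj₀
    obtain ⟨c⟩ := Function.Embedding.nonempty_of_card_le hle
    have hc : ∀ a, ∀ j ∈ S, G.adj (c a) j ≠ 0 := fun a j hj => by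
      rw [hcols j hj j₀ hj₀]
      exact (c a).2
    refine G.dim_le_of_forall_exists_rotation hcols hCrows (fun p => ((c p.1).1, s p.2)) ?_
      (fun p => hc _ _ (hsS _)) fun E => ?_
    · rintro ⟨a, b⟩ ⟨a', b'⟩ h
      simpa [Subtype.ext_iff.symm, c.injective.eq_iff, s.injective.eq_iff] using h
    · obtain ⟨Q, hQ, hS, hA⟩ := exists_orthogonal_actsWithin s (of fun a j => E (c a) j)
      rw [hs] at hS
      refine ⟨Q, hQ, hS, fun ⟨a, b⟩ hab => ?_⟩
      have h := hA a b hab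
      have hca := hc a (s b) (hsS b)
      generalize hv : (c a).1 = v at hca
      simp only [mul_apply, of_apply, hv] at h
      rcases v with i | i
      · simpa [changeLatent, mul_apply] using h
      · have hi : i ∉ (S : Set (Fin n)) := fun hi => hca (hCzero i hi _ (hsS b))
        rw [changeLatent, fromRows_apply_inr, Matrix.mul_assoc, ← transpose_apply (Qᵀ * _),
          transpose_mul, transpose_transpose, hS.mul_apply_of_notMem _ _ hi, transpose_apply,
          mul_apply]
        exact mul_eq_zero_of_left h _
  · have hle : Fintype.card (Fin k) ≤ Fintype.card {i // G.C j₀ i ≠ 0} := by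
      rw [Fintype.card_subtype, Fintype.card_fin]
      exact hcount j₀ hj₀
    obtain ⟨c⟩ := Function.Embedding.nonempty_of_card_le hle
    have hc : ∀ a, ∀ j ∈ S, G.C j (c a) ≠ 0 := fun a j hj => by
      rw [hCrows j hj j₀ hj₀]
      exact (c a).2
    refine G.dim_le_of_forall_exists_rotation hcols hCrows
      (fun p => (Sum.inr (s p.2), (c p.1).1)) ?_ (fun p => hc _ _ (hsS _)) fun E => ?_
    · rintro ⟨a, b⟩ ⟨a', b'⟩ h
      simpa [Subtype.ext_iff.symm, c.injective.eq_iff, s.injective.eq_iff, and_comm] using h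
    · obtain ⟨Q, hQ, hS, hA⟩ :=
        exists_orthogonal_actsWithin s (of fun a j => E (Sum.inr j) (c a))
      rw [hs] at hS
      refine ⟨Q, hQ, hS, fun ⟨a, b⟩ hab => ?_⟩
      have hi : (c a).1 ∉ (S : Set (Fin n)) := fun hi => hc a (s b) (hsS b) (hCzero _ (hsS b) _ hi)
      have h := hA a b hab
      simp only [changeLatent, fromRows_apply_inr]
      rw [hS.mul_apply_of_notMem _ _ hi]
      refine mul_eq_zero_of_left ?_ _
      simpa [mul_apply, mul_comm] using h

end
end

section
/- Lemma (removing edges): Let G = (B_G, C_G) be a pattern with m measured and n latent variables. Suppose there is a set S of latent indices with |S| = k ≥ 2 such that all indices j ∈ S have identical columns in B_G, identical columns in C_G, and identical rows in C_G (the latent variables indexed by S have the same set of parents and the same set of children), and suppose that the common number of children (the number of nonzero entries in the common column of B_G plus the number of nonzero entries in the common column of C_G) is at least k [respectively, the common number of parents is at least k]. Then there exists a pattern G̃ = (B̃_G, C̃_G) with B̃_G ≤ B_G and C̃_G ≤ C_G entrywise, agreeing with (B_G, C_G) in all entries except k(k−1)/2 entries that are set to zero, all of which lie in the columns of B_G and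 C_G indexed by S [respectively, in the rows of C_G indexed by S], such that M(G̃) = M(G). -/
open Matrix

noncomputable section

theorem card_filter_fst_lt_snd (α : Type*) [Fintype α] [LinearOrder α] :
    (Finset.univ.filter fun p : α × α => p.1 < p.2).card =
      Fintype.card α * (Fintype.card α - 1) / 2 := by
  have hswap : (Finset.univ.filter fun p : α × α => p.1 < p.2).card =
      (Finset.univ.filter fun p : α × α => p.2 < p.1).card :=
    Finset.card_equiv (Equiv.prodComm α α) (by simp)
  have hunion : (Finset.univ : Finset α).offDiag =
      (Finset.univ.filter fun p : α × α => p.1 < p.2) ∪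
        (Finset.univ.filter fun p : α × α => p.2 < p.1) := by
    ext p
    simp [lt_or_lt_iff_ne]
  have hdisj : Disjoint (Finset.univ.filter fun p : α × α => p.1 < p.2)
      (Finset.univ.filter fun p : α × α => p.2 < p.1) := by
    rw [Finset.disjoint_filter]
    exact fun p _ h => h.le.not_gt
  have hcard := congrArg Finset.card hunion
  rw [Finset.card_union_of_disjoint hdisj, ← hswap, Finset.offDiag_card, Finset.card_univ] at hcard
  rw [Nat.mul_sub, mul_one, hcard]
  omega

/-- A matrix `O` mixes only within `S` if off-diagonal entries are supported on `S × S`. -/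
def MixesWithin {ι : Type*} (S : Finset ι) (O : Matrix ι ι ℝ) : Prop :=
  ∀ i j, O i j ≠ 0 → i = j ∨ (i ∈ S ∧ j ∈ S)

theorem exists_orthogonal_triangular_s8 {ι : Type*} [Fintype ι] [LinearOrder ι] (S : Finset ι)
    (w : S → ι → ℝ) :
    ∃ O : Matrix ι ι ℝ, O * Oᵀ = 1 ∧ MixesWithin S O ∧
      ∀ s t : S, s < t → ∑ a, O t a * w s a = 0 := by
  classical
  let : LocallyFiniteOrderBot S :=
    .ofIic S (fun a => Finset.univ.filter (· ≤ a)) fun _ _ => Finset.mem_filter_univ _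
  set b := InnerProductSpace.gramSchmidtOrthonormalBasis (𝕜 := ℝ) (E := EuclideanSpace ℝ S)
    (ι := S) (by simp) (fun s => WithLp.toLp 2 fun a : S => w s a) with hb
  let O : Matrix ι ι ℝ := fun i j =>
    if h : i ∈ S ∧ j ∈ S then b ⟨i, h.1⟩ ⟨j, h.2⟩ else (1 : Matrix ι ι ℝ) i j
  have hrow : ∀ (t : S) (f : ι → ℝ), ∑ a, O t a * f a = ∑ a : S, b t a * f a := by
    intro t f
    rw [← Finset.sum_subset (Finset.subset_univ S), ← Finset.sum_coe_sort S]
    · exact Finset.sum_congr rfl fun a _ => by simp [O]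
    · intro a _ ha
      have hne : (t : ι) ≠ a := fun h => ha (h ▸ t.2)
      simp [O, ha, Matrix.one_apply, hne]
  have hout : ∀ i, i ∉ S → ∀ j, O i j = (1 : Matrix ι ι ℝ) i j := by
    intro i hi j
    simp [O, hi]
  have hmix : MixesWithin S O := by
    intro i j hij
    by_contra! hcon
    refine hij ?_
    have : ¬ (i ∈ S ∧ j ∈ S) := fun h => hcon.2 h.1 h.2
    simp only [O, dif_neg this, Matrix.one_apply, if_neg hcon.1]
  refine ⟨O, ?_, hmix, ?_⟩
  · ext i j
    rw [Matrix.mul_apply]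
    simp only [Matrix.transpose_apply]
    by_cases hi : i ∈ S
    · rw [hrow ⟨i, hi⟩ fun a => O j a]
      by_cases hj : j ∈ S
      · have horth := orthonormal_iff_ite.mp b.orthonormal ⟨j, hj⟩ ⟨i, hi⟩
        rw [PiLp.inner_apply] at horth
        simp only [Subtype.mk.injEq, RCLike.inner_apply, conj_trivial] at horth
        rw [Matrix.one_apply]
        simp only [eq_comm (a := i)]
        rw [← horth]
        exact Finset.sum_congr rfl fun a _ => by simp [O, hj]
      · rw [Matrix.one_apply_ne (fun h : i = j => hj (h ▸ hi))]
        refine Finset.sum_eq_zero fun a _ => ?_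
        rw [hout j hj, Matrix.one_apply_ne (fun h : j = (a : ι) => hj (h ▸ a.2)), mul_zero]
    · simp only [hout i hi, Matrix.one_apply, ite_mul, one_mul, zero_mul, Finset.sum_ite_eq,
        Finset.mem_univ, if_true]
      by_contra hne
      split_ifs at hne with hij
      · subst hij
        simp [hout i hi] at hne
      · rcases hmix j i hne with h | h
        · exact hij h.symm
        · exact hi h.2
  · intro s t hst
    rw [hrow]
    have horth := InnerProductSpace.gramSchmidtOrthonormalBasis_inv_triangular (𝕜 := ℝ)
      (E := EuclideanSpace ℝ S) (ι := S) (by simp)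
      (fun s => WithLp.toLp 2 fun a : S => w s a) hst
    rw [← hb, PiLp.inner_apply] at horth
    simpa [mul_comm] using horth

theorem Pattern.distSet_mono {m n : ℕ} {G H : Pattern m n} (hB : ∀ i j, H.B i j ≤ G.B i j)
    (hC : ∀ i j, H.C i j ≤ G.C i j) : H.distSet ⊆ G.distSet := by
  rintro _ ⟨B, C, dX, dL, hB', hCu, hC', hX, hL, rfl⟩
  exact ⟨B, C, dX, dL, fun i j h => hB' i j (Nat.le_zero.mp (h ▸ hB i j)), hCu,
    fun i j h => hC' i j (Nat.le_zero.mp (h ▸ hC i j)), hX, hL, rfl⟩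

/-- Rescaling the latent variables to unit noise variance and rotating them by `O` gives another
parametrization of the same covariance matrix. -/
theorem Pattern.mem_distSet_of_rotation {m n : ℕ} (H : Pattern m n)
    (B : Matrix (Fin m) (Fin n) ℝ) (C : Matrix (Fin n) (Fin n) ℝ) (dX : Fin m → ℝ)
    (dL : Fin n → ℝ) (hX : ∀ i, 0 < dX i) (hL : ∀ i, 0 < dL i) (O : Matrix (Fin n) (Fin n) ℝ)
    (hO : O * Oᵀ = 1)
    (hB : ∀ i j, H.B i j = 0 → ∑ b, B i b * (√(dL b) * O j b) = 0)
    (hC : ∀ i j, H.C i j = 0 →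
      ∑ a, ∑ b, O i a * (√(dL a))⁻¹ * C a b * (√(dL b) * O j b) = 0) :
    B * (1 - C)⁻¹ * diagonal dL * ((1 - C)⁻¹)ᵀ * Bᵀ + diagonal dX ∈ H.distSet := by
  set D : Matrix (Fin n) (Fin n) ℝ := diagonal fun a => √(dL a) with hD
  set E : Matrix (Fin n) (Fin n) ℝ := diagonal fun a => (√(dL a))⁻¹ with hE
  have hpos : ∀ a, √(dL a) ≠ 0 := fun a => (Real.sqrt_pos.mpr (hL a)).ne'
  have hDE : D * E = 1 := by
    rw [hD, hE, diagonal_mul_diagonal, ← diagonal_one]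
    exact congrArg diagonal (funext fun a => mul_inv_cancel₀ (hpos a))
  have hDD : diagonal dL = D * D := by
    rw [hD, diagonal_mul_diagonal]
    exact congrArg diagonal (funext fun a => (Real.mul_self_sqrt (hL a).le).symm)
  have hO' : Oᵀ * O = 1 := mul_eq_one_comm.mp hO
  set P := D * Oᵀ with hP
  set Q := O * E with hQ
  have hPQ : P * Q = 1 := by
    rw [hP, hQ, Matrix.mul_assoc, ← Matrix.mul_assoc Oᵀ, hO', Matrix.one_mul, hDE]
  have hQP : Q * P = 1 := mul_eq_one_comm.mp hPQ
  have hPP : P * Pᵀ = diagonal dL := by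
    rw [hP, transpose_mul, transpose_transpose, Matrix.mul_assoc, ← Matrix.mul_assoc Oᵀ, hO',
      Matrix.one_mul, hDD, hD, diagonal_transpose]
  have hBentry : ∀ i j, (B * P) i j = ∑ b, B i b * (√(dL b) * O j b) := by
    intro i j
    simp [Matrix.mul_apply, hP, hD, Matrix.diagonal_apply]
  have hCentry : ∀ i j, (Q * C * P) i j =
      ∑ a, ∑ b, O i a * (√(dL a))⁻¹ * C a b * (√(dL b) * O j b) := by
    intro i j
    rw [Finset.sum_comm]
    simp [Matrix.mul_apply, hP, hQ, hE, hD, Matrix.diagonal_apply, Finset.sum_mul]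
  have hinv : (1 - Q * C * P)⁻¹ = Q * (1 - C)⁻¹ * P := by
    have : 1 - Q * C * P = Q * (1 - C) * P := by
      rw [Matrix.mul_sub, Matrix.sub_mul, Matrix.mul_one, hQP]
    rw [this, Matrix.mul_inv_rev _ P, Matrix.mul_inv_rev Q, Matrix.inv_eq_right_inv hPQ,
      Matrix.inv_eq_right_inv hQP, Matrix.mul_assoc Q]
  have hBinv : B * P * (Q * (1 - C)⁻¹ * P) = B * (1 - C)⁻¹ * P := by
    simp only [Matrix.mul_assoc]
    rw [← Matrix.mul_assoc P Q, hPQ, Matrix.one_mul]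
  refine ⟨B * P, Q * C * P, dX, fun _ => 1, fun i j h => (hBentry i j).trans (hB i j h),
    fun i j h => (hCentry i j).trans (hC i j (H.hCstrict i j h)),
    fun i j h => (hCentry i j).trans (hC i j h), hX, fun _ => one_pos, ?_⟩
  have hcov : B * P * (1 - Q * C * P)⁻¹ * diagonal (fun _ : Fin n => (1 : ℝ)) *
      ((1 - Q * C * P)⁻¹)ᵀ * (B * P)ᵀ = (B * (1 - C)⁻¹ * P) * (B * (1 - C)⁻¹ * P)ᵀ := by
    rw [diagonal_one, Matrix.mul_one, Matrix.mul_assoc _ _ᵀ, ← transpose_mul, hinv, hBinv]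
  rw [hcov, transpose_mul, Matrix.mul_assoc _ P, ← Matrix.mul_assoc P, hPP, transpose_mul]
  simp only [Matrix.mul_assoc]

/-- The pattern obtained from `G` by setting the entries of `B` in `RB` and of `C` in `RC`
to zero. -/
def Pattern.erase {m n : ℕ} (G : Pattern m n) (RB : Finset (Fin m × Fin n))
    (RC : Finset (Fin n × Fin n)) : Pattern m n where
  B := fun i j => if (i, j) ∈ RB then 0 else G.B i j
  C := fun i j => if (i, j) ∈ RC then 0 else G.C i j
  hB := fun i j => by have := G.hB i j; split_ifs <;> omega
  hC := fun i j => by have := G.hC i j; split_ifs <;> omega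
  hCstrict := fun i j h => by rw [G.hCstrict i j h, ite_self]

section IndistinguishableLatents

variable {m n : ℕ} {G : Pattern m n} {S : Finset (Fin n)}

theorem Pattern.C_eq_zero_of_mem
    (hCrows : ∀ j₁ ∈ S, ∀ j₂ ∈ S, ∀ i : Fin n, G.C j₁ i = G.C j₂ i)
    {i j : Fin n} (hi : i ∈ S) (hj : j ∈ S) : G.C i j = 0 := by
  rw [hCrows i hi j hj, G.hCstrict j j le_rfl]

theorem Pattern.rotation_B_eq_zero {B : Matrix (Fin m) (Fin n) ℝ} {O : Matrix (Fin n) (Fin n) ℝ}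
    (hBcols : ∀ j₁ ∈ S, ∀ j₂ ∈ S, ∀ i : Fin m, G.B i j₁ = G.B i j₂)
    (hB : ∀ i j, G.B i j = 0 → B i j = 0) (hmix : MixesWithin S O) (r : Fin n → ℝ)
    {i : Fin m} {j : Fin n} (h : G.B i j = 0) : ∑ b, B i b * (r b * O j b) = 0 := by
  refine Finset.sum_eq_zero fun b _ => ?_
  by_cases hO : O j b = 0
  · simp [hO]
  · have : G.B i b = 0 := by
      rcases hmix j b hO with rfl | ⟨hj, hb⟩
      · exact h
      · rw [hBcols b hb j hj, h]
    simp [hB i b this]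

theorem Pattern.rotation_C_eq_zero {C O : Matrix (Fin n) (Fin n) ℝ}
    (hCcols : ∀ j₁ ∈ S, ∀ j₂ ∈ S, ∀ i : Fin n, G.C i j₁ = G.C i j₂)
    (hCrows : ∀ j₁ ∈ S, ∀ j₂ ∈ S, ∀ i : Fin n, G.C j₁ i = G.C j₂ i)
    (hC : ∀ i j, G.C i j = 0 → C i j = 0) (hmix : MixesWithin S O) (r : Fin n → ℝ)
    {i j : Fin n} (h : G.C i j = 0) :
    ∑ a, ∑ b, O i a * (r a)⁻¹ * C a b * (r b * O j b) = 0 := by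
  refine Finset.sum_eq_zero fun a _ => Finset.sum_eq_zero fun b _ => ?_
  by_cases hia : O i a = 0
  · simp [hia]
  by_cases hjb : O j b = 0
  · simp [hjb]
  have : G.C a b = 0 := by
    have hab : G.C a b = G.C i b := by
      rcases hmix i a hia with rfl | ⟨hi, ha⟩
      · rfl
      · exact hCrows a ha i hi b
    rcases hmix j b hjb with rfl | ⟨hj, hb⟩
    · rw [hab, h]
    · rw [hab, hCcols b hb j hj, h]
  simp [hC a b this]

/-- Edges from `S` to children can be removed in triangular shape. -/
theorem Pattern.distSet_erase_children {RB : Finset (Fin m × Fin n)} {RC : Finset (Fin n × Fin n)}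
    (hBcols : ∀ j₁ ∈ S, ∀ j₂ ∈ S, ∀ i : Fin m, G.B i j₁ = G.B i j₂)
    (hCcols : ∀ j₁ ∈ S, ∀ j₂ ∈ S, ∀ i : Fin n, G.C i j₁ = G.C i j₂)
    (hCrows : ∀ j₁ ∈ S, ∀ j₂ ∈ S, ∀ i : Fin n, G.C j₁ i = G.C j₂ i)
    (χ : S → Fin m ⊕ Fin n)
    (hRB : ∀ p ∈ RB, ∃ s t : S, s < t ∧ χ s = Sum.inl p.1 ∧ (t : Fin n) = p.2)
    (hRC : ∀ p ∈ RC, G.C p.1 p.2 ≠ 0 ∧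
      ∃ s t : S, s < t ∧ χ s = Sum.inr p.1 ∧ (t : Fin n) = p.2) :
    G.distSet ⊆ (G.erase RB RC).distSet := by
  rintro _ ⟨B, C, dX, dL, hB, -, hC, hX, hL, rfl⟩
  obtain ⟨O, hO, hmix, htri⟩ := exists_orthogonal_triangular_s8 S
    fun s a => Sum.elim (fun i => B i a) (fun i => C i a) (χ s) * √(dL a)
  refine Pattern.mem_distSet_of_rotation _ B C dX dL hX hL O hO ?_ ?_
  · intro i j hij
    by_cases hR : (i, j) ∈ RB
    · obtain ⟨s, t, hst, hs, rfl⟩ := hRB _ hR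
      rw [← htri s t hst]
      exact Finset.sum_congr rfl fun b _ => by simp only [hs, Sum.elim_inl]; ring
    · simp only [Pattern.erase, if_neg hR] at hij
      exact Pattern.rotation_B_eq_zero hBcols hB hmix _ hij
  · intro i j hij
    by_cases hR : (i, j) ∈ RC
    · obtain ⟨hne, s, t, hst, hs, rfl⟩ := hRC _ hR
      have hi : i ∉ S := fun hi => hne (Pattern.C_eq_zero_of_mem hCrows hi t.2)
      refine Finset.sum_eq_zero fun a _ => ?_
      by_cases hia : O i a = 0
      · simp [hia]
      obtain rfl : i = a := (hmix i a hia).resolve_right fun h => hi h.1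
      rw [← mul_zero (O i i * (√(dL i))⁻¹), ← htri s t hst, Finset.mul_sum]
      exact Finset.sum_congr rfl fun b _ => by simp only [hs, Sum.elim_inr]; ring
    · simp only [Pattern.erase, if_neg hR] at hij
      exact Pattern.rotation_C_eq_zero hCcols hCrows hC hmix _ hij

/-- Edges from parents to `S` can be removed in triangular shape. -/
theorem Pattern.distSet_erase_parents {RC : Finset (Fin n × Fin n)}
    (hBcols : ∀ j₁ ∈ S, ∀ j₂ ∈ S, ∀ i : Fin m, G.B i j₁ = G.B i j₂)
    (hCcols : ∀ j₁ ∈ S, ∀ j₂ ∈ S, ∀ i : Fin n, G.C i j₁ = G.C i j₂)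
    (hCrows : ∀ j₁ ∈ S, ∀ j₂ ∈ S, ∀ i : Fin n, G.C j₁ i = G.C j₂ i)
    (χ : S → Fin n)
    (hRC : ∀ p ∈ RC, G.C p.1 p.2 ≠ 0 ∧
      ∃ s t : S, s < t ∧ χ s = p.2 ∧ (t : Fin n) = p.1) :
    G.distSet ⊆ (G.erase ∅ RC).distSet := by
  rintro _ ⟨B, C, dX, dL, hB, -, hC, hX, hL, rfl⟩
  obtain ⟨O, hO, hmix, htri⟩ := exists_orthogonal_triangular_s8 S
    fun s a => (√(dL a))⁻¹ * C a (χ s)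
  refine Pattern.mem_distSet_of_rotation _ B C dX dL hX hL O hO ?_ ?_
  · intro i j hij
    exact Pattern.rotation_B_eq_zero hBcols hB hmix _ (by simpa [Pattern.erase] using hij)
  · intro i j hij
    by_cases hR : (i, j) ∈ RC
    · obtain ⟨hne, s, t, hst, rfl, rfl⟩ := hRC _ hR
      have hj : χ s ∉ S := fun hj => hne (Pattern.C_eq_zero_of_mem hCrows t.2 hj)
      rw [Finset.sum_comm]
      refine Finset.sum_eq_zero fun b _ => ?_
      by_cases hjb : O (χ s) b = 0
      · simp [hjb]
      obtain rfl : χ s = b := (hmix _ b hjb).resolve_right fun h => hj h.1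
      rw [← zero_mul (√(dL (χ s)) * O (χ s) (χ s)), ← htri s t hst, Finset.sum_mul]
      exact Finset.sum_congr rfl fun a _ => by ring
    · simp only [Pattern.erase, if_neg hR] at hij
      exact Pattern.rotation_C_eq_zero hCcols hCrows hC hmix _ hij

end IndistinguishableLatents

theorem Pattern.erase_B_le {m n : ℕ} (G : Pattern m n) (RB : Finset (Fin m × Fin n))
    (RC : Finset (Fin n × Fin n)) (i : Fin m) (j : Fin n) : (G.erase RB RC).B i j ≤ G.B i j := by
  simp only [Pattern.erase]
  split_ifs <;> simp

theorem Pattern.erase_C_le {m n : ℕ} (G : Pattern m n) (RB : Finset (Fin m × Fin n))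
    (RC : Finset (Fin n × Fin n)) (i j : Fin n) : (G.erase RB RC).C i j ≤ G.C i j := by
  simp only [Pattern.erase]
  split_ifs <;> simp

theorem Pattern.mem_of_erase_B_ne {m n : ℕ} (G : Pattern m n) {RB : Finset (Fin m × Fin n)}
    {RC : Finset (Fin n × Fin n)} {i : Fin m} {j : Fin n}
    (h : (G.erase RB RC).B i j ≠ G.B i j) : (i, j) ∈ RB :=
  Classical.byContradiction fun hR => h (if_neg hR)

theorem Pattern.mem_of_erase_C_ne {m n : ℕ} (G : Pattern m n) {RB : Finset (Fin m × Fin n)}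
    {RC : Finset (Fin n × Fin n)} {i j : Fin n}
    (h : (G.erase RB RC).C i j ≠ G.C i j) : (i, j) ∈ RC :=
  Classical.byContradiction fun hR => h (if_neg hR)

theorem Pattern.filter_erase_B_ne {m n : ℕ} (G : Pattern m n) {RB : Finset (Fin m × Fin n)}
    (RC : Finset (Fin n × Fin n)) (hRB : ∀ p ∈ RB, G.B p.1 p.2 ≠ 0) :
    (Finset.univ.filter fun p : Fin m × Fin n => (G.erase RB RC).B p.1 p.2 ≠ G.B p.1 p.2) = RB := by
  ext p
  rw [Finset.mem_filter_univ]
  exact ⟨G.mem_of_erase_B_ne, fun hp h => hRB p hp (h.symm.trans (if_pos hp))⟩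

theorem Pattern.filter_erase_C_ne {m n : ℕ} (G : Pattern m n) (RB : Finset (Fin m × Fin n))
    {RC : Finset (Fin n × Fin n)} (hRC : ∀ p ∈ RC, G.C p.1 p.2 ≠ 0) :
    (Finset.univ.filter fun p : Fin n × Fin n => (G.erase RB RC).C p.1 p.2 ≠ G.C p.1 p.2) = RC := by
  ext p
  rw [Finset.mem_filter_univ]
  exact ⟨G.mem_of_erase_C_ne, fun hp h => hRC p hp (h.symm.trans (if_pos hp))⟩

theorem Pattern.distSet_erase_subset {m n : ℕ} (G : Pattern m n) (RB : Finset (Fin m × Fin n))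
    (RC : Finset (Fin n × Fin n)) : (G.erase RB RC).distSet ⊆ G.distSet :=
  Pattern.distSet_mono (G.erase_B_le RB RC) (G.erase_C_le RB RC)

theorem exists_injective_mem {α β : Type*} (S : Finset α) (T : Finset β) (h : S.card ≤ T.card) :
    ∃ χ : S → β, Function.Injective χ ∧ ∀ s, χ s ∈ T := by
  obtain ⟨f⟩ := Function.Embedding.nonempty_of_card_le
    (α := S) (β := T) (by simpa using h)
  exact ⟨fun s => f s, Subtype.val_injective.comp f.injective, fun s => (f s).2⟩

/-- The triangular set of positions `(χ s, t)` with `s < t` in `S`. -/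
def triangularPositions {α β : Type*} [LinearOrder α] [DecidableEq β] (S : Finset α) (χ : S → β) :
    Finset (β × α) :=
  (Finset.univ.filter fun p : S × S => p.1 < p.2).image fun p => (χ p.1, (p.2 : α))

theorem mem_triangularPositions {α β : Type*} [LinearOrder α] [DecidableEq β] {S : Finset α}
    {χ : S → β} {p : β × α} :
    p ∈ triangularPositions S χ ↔ ∃ s t : S, s < t ∧ χ s = p.1 ∧ (t : α) = p.2 := by
  simp only [triangularPositions, Finset.mem_image, Finset.mem_filter, Finset.mem_univ, true_and,
    Prod.exists, Prod.ext_iff]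

theorem card_triangularPositions {α β : Type*} [LinearOrder α] [DecidableEq β] {S : Finset α}
    {χ : S → β} (hχ : Function.Injective χ) :
    (triangularPositions S χ).card = S.card * (S.card - 1) / 2 := by
  have hinj : Function.Injective fun p : S × S => (χ p.1, (p.2 : α)) :=
    hχ.prodMap Subtype.val_injective
  rw [triangularPositions, Finset.card_image_of_injective _ hinj, card_filter_fst_lt_snd, Fintype.card_coe]

theorem card_filter_inl_add_card_filter_inr {α β γ : Type*} [Fintype α] [Fintype β] [Fintype γ]
    [DecidableEq α] [DecidableEq β] [DecidableEq γ] (R : Finset ((α ⊕ β) × γ)) :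
    (Finset.univ.filter fun p : α × γ => (Sum.inl p.1, p.2) ∈ R).card +
      (Finset.univ.filter fun p : β × γ => (Sum.inr p.1, p.2) ∈ R).card = R.card := by
  rw [← Finset.card_disjSum]
  refine Finset.card_equiv (Equiv.sumProdDistrib α β γ).symm ?_
  rintro (p | p) <;> simp

/-- **Lemma (removing edges).** Suppose `k ≥ 2` latent variables (indexed by `S`) have the
same set of parents and the same set of children. If the common number of children is at
least `k`, there is a pattern `G̃ ≤ G` agreeing with `G` except for `k(k−1)/2` entries, all
in the columns of `B_G` and `C_G` indexed by `S`, that are set to zero, with `M(G̃) = M(G)`;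
respectively, if the common number of parents is at least `k`, the removed entries all lie in
the rows of `C_G` indexed by `S`. -/
theorem removing_edges {m n : ℕ} (G : Pattern m n) (S : Finset (Fin n)) (k : ℕ)
    (hk : 2 ≤ k) (hcard : S.card = k)
    (hBcols : ∀ j₁ ∈ S, ∀ j₂ ∈ S, ∀ i : Fin m, G.B i j₁ = G.B i j₂)
    (hCcols : ∀ j₁ ∈ S, ∀ j₂ ∈ S, ∀ i : Fin n, G.C i j₁ = G.C i j₂)
    (hCrows : ∀ j₁ ∈ S, ∀ j₂ ∈ S, ∀ i : Fin n, G.C j₁ i = G.C j₂ i) :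
    ((∀ j ∈ S, k ≤ G.childCount j) →
      ∃ Gt : Pattern m n,
        (∀ i j, Gt.B i j ≤ G.B i j) ∧ (∀ i j, Gt.C i j ≤ G.C i j) ∧
        (∀ i j, Gt.B i j ≠ G.B i j → Gt.B i j = 0 ∧ j ∈ S) ∧
        (∀ i j, Gt.C i j ≠ G.C i j → Gt.C i j = 0 ∧ j ∈ S) ∧
        (Finset.univ.filter fun p : Fin m × Fin n => Gt.B p.1 p.2 ≠ G.B p.1 p.2).card +
          (Finset.univ.filter fun p : Fin n × Fin n => Gt.C p.1 p.2 ≠ G.C p.1 p.2).card =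
          k * (k - 1) / 2 ∧
        Gt.distSet = G.distSet) ∧
    ((∀ j ∈ S, k ≤ G.parentCount j) →
      ∃ Gt : Pattern m n,
        Gt.B = G.B ∧ (∀ i j, Gt.C i j ≤ G.C i j) ∧
        (∀ i j, Gt.C i j ≠ G.C i j → Gt.C i j = 0 ∧ i ∈ S) ∧
        (Finset.univ.filter fun p : Fin n × Fin n => Gt.C p.1 p.2 ≠ G.C p.1 p.2).card =
          k * (k - 1) / 2 ∧
        Gt.distSet = G.distSet) := by
  classical
  obtain ⟨j₀, hj₀⟩ : S.Nonempty := Finset.card_pos.mp (by omega)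
  constructor
  · intro hchild
    set T := (Finset.univ.filter fun i : Fin m => G.B i j₀ ≠ 0).disjSum
      (Finset.univ.filter fun i : Fin n => G.C i j₀ ≠ 0) with hT
    obtain ⟨χ, hχ, hχT⟩ := exists_injective_mem S T
      (by rw [hT, Finset.card_disjSum, hcard]; exact hchild j₀ hj₀)
    set R := triangularPositions S χ with hR
    set RB := Finset.univ.filter fun p : Fin m × Fin n => (Sum.inl p.1, p.2) ∈ R with hRB
    set RC := Finset.univ.filter fun p : Fin n × Fin n => (Sum.inr p.1, p.2) ∈ R with hRC
    have memRB : ∀ p ∈ RB, ∃ s t : S, s < t ∧ χ s = Sum.inl p.1 ∧ (t : Fin n) = p.2 := by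
      intro p hp
      exact mem_triangularPositions.mp (Finset.mem_filter.mp hp).2
    have memRC : ∀ p ∈ RC, ∃ s t : S, s < t ∧ χ s = Sum.inr p.1 ∧ (t : Fin n) = p.2 := by
      intro p hp
      exact mem_triangularPositions.mp (Finset.mem_filter.mp hp).2
    have neRB : ∀ p ∈ RB, G.B p.1 p.2 ≠ 0 := by
      intro p hp
      obtain ⟨s, t, -, hs, ht⟩ := memRB p hp
      have := hχT s
      rw [hs, hT, Finset.inl_mem_disjSum, Finset.mem_filter] at this
      rw [← ht, hBcols t t.2 j₀ hj₀]
      exact this.2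
    have neRC : ∀ p ∈ RC, G.C p.1 p.2 ≠ 0 := by
      intro p hp
      obtain ⟨s, t, -, hs, ht⟩ := memRC p hp
      have := hχT s
      rw [hs, hT, Finset.inr_mem_disjSum, Finset.mem_filter] at this
      rw [← ht, hCcols t t.2 j₀ hj₀]
      exact this.2
    refine ⟨G.erase RB RC, G.erase_B_le RB RC, G.erase_C_le RB RC, ?_, ?_, ?_, ?_⟩
    · intro i j hij
      have hmem := G.mem_of_erase_B_ne hij
      obtain ⟨s, t, -, -, rfl⟩ := memRB _ hmem
      exact ⟨if_pos hmem, t.2⟩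
    · intro i j hij
      have hmem := G.mem_of_erase_C_ne hij
      obtain ⟨s, t, -, -, rfl⟩ := memRC _ hmem
      exact ⟨if_pos hmem, t.2⟩
    · rw [G.filter_erase_B_ne RC neRB, G.filter_erase_C_ne RB neRC,
        card_filter_inl_add_card_filter_inr, card_triangularPositions hχ, hcard]
    · exact (G.distSet_erase_subset RB RC).antisymm
        (Pattern.distSet_erase_children hBcols hCcols hCrows χ memRB
          fun p hp => ⟨neRC p hp, memRC p hp⟩)
  · intro hparent
    obtain ⟨χ, hχ, hχT⟩ := exists_injective_mem S (Finset.univ.filter fun i => G.C j₀ i ≠ 0)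
      (by rw [hcard]; exact hparent j₀ hj₀)
    set RC := (triangularPositions S χ).map (Equiv.prodComm (Fin n) (Fin n)).toEmbedding with hRC
    have memRC : ∀ p ∈ RC, ∃ s t : S, s < t ∧ χ s = p.2 ∧ (t : Fin n) = p.1 := by
      intro p hp
      rw [hRC, Finset.mem_map_equiv] at hp
      exact mem_triangularPositions.mp hp
    have neRC : ∀ p ∈ RC, G.C p.1 p.2 ≠ 0 := by
      intro p hp
      obtain ⟨s, t, -, hs, ht⟩ := memRC p hp
      rw [← ht, ← hs, hCrows t t.2 j₀ hj₀]
      exact (Finset.mem_filter.mp (hχT s)).2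
    refine ⟨G.erase ∅ RC, by ext i j; simp [Pattern.erase], G.erase_C_le ∅ RC, ?_, ?_, ?_⟩
    · intro i j hij
      have hmem := G.mem_of_erase_C_ne hij
      obtain ⟨s, t, -, -, rfl⟩ := memRC _ hmem
      exact ⟨if_pos hmem, t.2⟩
    · rw [G.filter_erase_C_ne ∅ neRC, hRC, Finset.card_map, card_triangularPositions hχ, hcard]
    · exact (G.distSet_erase_subset ∅ RC).antisymm
        (Pattern.distSet_erase_parents hBcols hCcols hCrows χ
          fun p hp => ⟨neRC p hp, memRC p hp⟩)

end
end
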